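/- arXiv:1905.05397 — 6 statements merged into one kernel-verified Lean document; each statement's English description precedes it below -/
import Mathlib

section
/- For every n ∈ ℕ and p ∈ [0,1], the forward depth-first forest F_{G⃗(n,p)} of the random directed graph G⃗(n,p) has the same distribution as the depth-first forest F_{G(n,p)} of the Erdős–Rényi random graph G(n,p). -/
/-!
The forward depth-first forest of the random directed graph `G⃗(n,p)` has the same
distribution as the depth-first forest of the Erdős–Rényi graph `G(n,p)`.

Graphs on `[n] = {1,…,n}` are encoded as functions `Fin n → Fin n → Bool` (adjacency,
`d u w = true` meaning there is a (directed) edge from `u` to `w`); vertex `1` corresponds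
to `(0 : Fin n)` and the increasing order on labels is the order on `Fin n`.
-/

open Finset

namespace DFSExploration

/-- The state of the depth-first exploration: the ordered stack `𝒪ᵢ` of open vertices, the
list of explored vertices (in order of exploration), and the list of forest edges found. -/
structure State (n : ℕ) where
  stack : List (Fin n)
  visited : List (Fin n)
  forest : List (Fin n × Fin n)

/-- One step of the depth-first exploration of the (directed) graph with adjacency `adj`:
the first vertex `v` of the stack is explored; its (out-)neighbours which have not been
seen yet are added at the front of the stack, in increasing order; if the stack becomes
empty, the smallest unexplored vertex is put on it. -/
def step {n : ℕ} (adj : Fin n → Fin n → Bool) (s : State n) : State n :=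
  match s.stack with
  | [] => s
  | v :: rest =>
    let visited' := s.visited ++ [v]
    let ns := (List.finRange n).filter
      (fun w => adj v w && !(decide (w ∈ s.stack)) && !(decide (w ∈ s.visited)))
    let stack' := ns ++ rest
    let stack'' := if stack'.isEmpty then
        ((List.finRange n).filter (fun w => !(decide (w ∈ visited')))).take 1
      else stack'
    ⟨stack'', visited', s.forest ++ ns.map (fun w => (v, w))⟩

/-- The result of running the depth-first exploration, started from vertex `1`
(i.e. `0 : Fin n`). -/
def run {n : ℕ} (adj : Fin n → Fin n → Bool) : State n :=
  (step adj)^[n] ⟨(List.finRange n).take 1, [], []⟩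

/-- The depth-first forest of a graph, as the list of its edges `(vᵢ, w)`, `w ∈ 𝒩ᵢ`, in
order of appearance.  For a directed graph this is the forward depth-first forest
`F_{G⃗}`; for an undirected graph (symmetric adjacency function) it is the depth-first
forest `F_G`. -/
def dfsForest {n : ℕ} (adj : Fin n → Fin n → Bool) : List (Fin n × Fin n) :=
  (run adj).forest

/-- The probability that the random directed graph `G⃗(n,p)` (each of the `n(n-1)` possible
directed edges present independently with probability `p`) equals a given directed graph
`d`; it is `0` if `d` has a self-loop. -/
noncomputable def dirProb (n : ℕ) (p : ℝ) (d : Fin n → Fin n → Bool) : ℝ :=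
  if ∀ i, d i i = false then
    ∏ x ∈ univ.filter (fun x : Fin n × Fin n => x.1 ≠ x.2),
      (if d x.1 x.2 then p else 1 - p)
  else 0

/-- The probability that the Erdős–Rényi graph `G(n,p)` (each of the `n(n-1)/2` possible
undirected edges present independently with probability `p`) equals a given undirected
graph `g` (encoded as a symmetric irreflexive adjacency function); it is `0` if `g` is not
symmetric irreflexive. -/
noncomputable def undirProb (n : ℕ) (p : ℝ) (g : Fin n → Fin n → Bool) : ℝ :=
  if (∀ i, g i i = false) ∧ (∀ i j, g i j = g j i) then
    ∏ x ∈ univ.filter (fun x : Fin n × Fin n => x.1 < x.2),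
      (if g x.1 x.2 then p else 1 - p)
  else 0

end DFSExploration

namespace DFSExploration

/-- `u` comes before `w` in the list `l`; vertices at the same position (for instance those
missing from `l`) are compared by their labels. -/
def Before {n : ℕ} (l : List (Fin n)) (u w : Fin n) : Prop :=
  l.idxOf u < l.idxOf w ∨ (l.idxOf u = l.idxOf w ∧ u < w)

instance {n : ℕ} (l : List (Fin n)) (u w : Fin n) : Decidable (Before l u w) :=
  inferInstanceAs (Decidable (_ ∨ _))

theorem Before.irrefl {n : ℕ} (l : List (Fin n)) (u : Fin n) : ¬ Before l u u := by
  simp [Before]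

theorem Before.asymm {n : ℕ} {l : List (Fin n)} {u w : Fin n} (h : Before l u w) :
    ¬ Before l w u := by
  unfold Before at *
  omega

theorem before_or_before {n : ℕ} (l : List (Fin n)) {u w : Fin n} (h : u ≠ w) :
    Before l u w ∨ Before l w u := by
  unfold Before
  omega

theorem before_of_mem_of_notMem {n : ℕ} {l l' : List (Fin n)} (h : l <+: l') {u w : Fin n}
    (hu : u ∈ l) (hw : w ∉ l) : Before l' u w := by
  obtain ⟨t, rfl⟩ := h
  left
  rw [List.idxOf_append_of_mem hu, List.idxOf_append_of_notMem hw]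
  have := List.idxOf_lt_length_of_mem hu
  omega

/-- `d` agrees with `g` on the pairs ordered by the depth-first exploration of `g`. -/
def Agree {n : ℕ} (g d : Fin n → Fin n → Bool) : Prop :=
  ∀ u w, Before (run g).visited u w → d u w = g u w

instance {n : ℕ} (g d : Fin n → Fin n → Bool) : Decidable (Agree g d) :=
  inferInstanceAs (Decidable (∀ _, _))

theorem visited_prefix_step {n : ℕ} (g : Fin n → Fin n → Bool) (s : State n) :
    s.visited <+: (step g s).visited := by
  unfold step
  split <;> simp

theorem visited_prefix_iterate {n : ℕ} (g : Fin n → Fin n → Bool) (s : State n) (k : ℕ) :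
    s.visited <+: ((step g)^[k] s).visited := by
  induction k with
  | zero => simp
  | succ k ih =>
    rw [Function.iterate_succ_apply']
    exact ih.trans (visited_prefix_step g _)

theorem step_congr {n : ℕ} {g d : Fin n → Fin n → Bool} {s : State n} {l : List (Fin n)}
    (hl : (step g s).visited <+: l) (h : ∀ u w, Before l u w → d u w = g u w) :
    step d s = step g s := by
  obtain ⟨stack, visited, forest⟩ := s
  cases stack with
  | nil => rfl
  | cons v rest =>
    have hf : (List.finRange n).filter
          (fun w => d v w && !(decide (w ∈ v :: rest)) && !(decide (w ∈ visited)))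
        = (List.finRange n).filter
          (fun w => g v w && !(decide (w ∈ v :: rest)) && !(decide (w ∈ visited))) := by
      refine List.filter_congr fun w _ => ?_
      by_cases hs : w ∈ v :: rest
      · simp [hs]
      by_cases hw : w ∈ visited
      · simp [hw]
      rw [h v w (before_of_mem_of_notMem hl (by simp [step]) ?_)]
      simp only [step, List.mem_append, List.mem_singleton, not_or]
      exact ⟨hw, fun e => hs (by simp [e])⟩
    simp only [step, hf]

theorem Agree.run_eq {n : ℕ} {g d : Fin n → Fin n → Bool} (h : Agree g d) :
    run d = run g := by
  have key : ∀ k ≤ n, (step d)^[k] ⟨(List.finRange n).take 1, [], []⟩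
      = (step g)^[k] ⟨(List.finRange n).take 1, [], []⟩ := by
    intro k
    induction k with
    | zero => simp
    | succ k ih =>
      intro hk
      rw [Function.iterate_succ_apply', Function.iterate_succ_apply', ih (by omega)]
      refine step_congr (l := (run g).visited) ?_ h
      rw [← Function.iterate_succ_apply' (step g)]
      obtain ⟨m, rfl⟩ := Nat.exists_eq_add_of_le' hk
      rw [run, Function.iterate_add_apply (step g) m]
      exact visited_prefix_iterate _ _ _
  exact key n le_rfl

/-- The undirected graph keeping, for each pair of vertices, the directed edge of `d` that
leaves the vertex explored first. -/
def symmetrize {n : ℕ} (d : Fin n → Fin n → Bool) (u w : Fin n) : Bool :=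
  if Before (run d).visited u w then d u w else d w u

theorem agree_symmetrize {n : ℕ} (d : Fin n → Fin n → Bool) : Agree d (symmetrize d) :=
  fun _ _ h => if_pos h

theorem run_symmetrize {n : ℕ} (d : Fin n → Fin n → Bool) : run (symmetrize d) = run d :=
  (agree_symmetrize d).run_eq

theorem symmetrize_comm {n : ℕ} (d : Fin n → Fin n → Bool) (u w : Fin n) :
    symmetrize d u w = symmetrize d w u := by
  rcases eq_or_ne u w with rfl | h
  · rfl
  rcases before_or_before (run d).visited h with h | h <;>
    simp [symmetrize, h, h.asymm]

theorem agree_iff_eq_symmetrize {n : ℕ} {g d : Fin n → Fin n → Bool}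
    (hg : ∀ i, g i i = false) (hs : ∀ i j, g i j = g j i) (hd : ∀ i, d i i = false) :
    Agree g d ↔ g = symmetrize d := by
  constructor
  · intro h
    funext u w
    rw [symmetrize, h.run_eq]
    split_ifs with hb
    · exact (h u w hb).symm
    · rcases eq_or_ne u w with rfl | hne
      · rw [hg, hd]
      · rw [hs, h w u ((before_or_before _ hne).resolve_left hb)]
  · rintro rfl u w hb
    rw [run_symmetrize] at hb
    exact (agree_symmetrize d u w hb).symm

theorem prod_before_eq_prod_lt {n : ℕ} {M : Type*} [CommMonoid M] (l : List (Fin n))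
    (f : Fin n → Fin n → M) (hf : ∀ i j, f i j = f j i) :
    ∏ x ∈ univ.filter (fun x : Fin n × Fin n => Before l x.1 x.2), f x.1 x.2
      = ∏ x ∈ univ.filter (fun x : Fin n × Fin n => x.1 < x.2), f x.1 x.2 := by
  refine Finset.prod_bij' (fun x _ => if x.1 < x.2 then x else x.swap)
    (fun x _ => if Before l x.1 x.2 then x else x.swap) ?_ ?_ ?_ ?_ ?_
  · rintro ⟨u, w⟩ h
    simp only [mem_filter, mem_univ, true_and] at h ⊢
    split_ifs with hlt
    · exact hlt
    · refine lt_of_le_of_ne (not_lt.1 hlt) fun e => ?_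
      obtain rfl : w = u := e
      exact Before.irrefl _ _ h
  · rintro ⟨u, w⟩ h
    simp only [mem_filter, mem_univ, true_and] at h ⊢
    split_ifs with hb
    · exact hb
    · exact (before_or_before l h.ne).resolve_left hb
  · rintro ⟨u, w⟩ h
    simp only [mem_filter, mem_univ, true_and] at h
    by_cases hlt : u < w <;> simp [hlt, h, h.asymm]
  · rintro ⟨u, w⟩ h
    simp only [mem_filter, mem_univ, true_and] at h
    by_cases hb : Before l u w <;> simp [hb, h, h.le]
  · rintro ⟨u, w⟩ h
    dsimp only
    split_ifs
    · rfl
    · exact hf u w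

theorem sum_prod_adj {n : ℕ} {R : Type*} [CommSemiring R] (f : Fin n × Fin n → Bool → R) :
    ∑ d : Fin n → Fin n → Bool, ∏ x : Fin n × Fin n, f x (d x.1 x.2)
      = ∏ x : Fin n × Fin n, ∑ b, f x b := by
  rw [Fintype.prod_sum]
  exact Fintype.sum_equiv (Equiv.curry _ _ _).symm _ _ fun d => rfl

theorem sum_agree_dirProb {n : ℕ} (p : ℝ) {g : Fin n → Fin n → Bool}
    (hg : ∀ i, g i i = false) (hs : ∀ i j, g i j = g j i) :
    ∑ d : Fin n → Fin n → Bool, (if Agree g d then dirProb n p d else 0) = undirProb n p g := by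
  let f : Fin n × Fin n → Bool → ℝ := fun x b =>
    if x.1 = x.2 then (if b = false then 1 else 0)
    else if Before (run g).visited x.1 x.2 ∧ b ≠ g x.1 x.2 then 0
    else if b then p else 1 - p
  have hprod : ∀ d : Fin n → Fin n → Bool,
      (if Agree g d then dirProb n p d else 0) = ∏ x : Fin n × Fin n, f x (d x.1 x.2) := by
    intro d
    by_cases ha : Agree g d
    · by_cases hd : ∀ i, d i i = false
      · rw [if_pos ha, dirProb, if_pos hd, Finset.prod_filter]
        refine Finset.prod_congr rfl fun x _ => ?_
        by_cases hx : x.1 = x.2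
        · simp [f, hx, hd]
        · have : ¬ (Before (run g).visited x.1 x.2 ∧ d x.1 x.2 ≠ g x.1 x.2) :=
            fun h => h.2 (ha _ _ h.1)
          simp only [f, if_neg hx, if_neg this, ne_eq, hx, not_false_eq_true, if_true]
      · rw [if_pos ha, dirProb, if_neg hd]
        obtain ⟨i, hi⟩ := not_forall.1 hd
        exact (Finset.prod_eq_zero (mem_univ (i, i)) (by simp [f, hi])).symm
    · rw [if_neg ha]
      simp only [Agree, not_forall] at ha
      obtain ⟨u, w, hb, hne⟩ := ha
      have huw : u ≠ w := by
        rintro rfl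
        exact Before.irrefl _ _ hb
      exact (Finset.prod_eq_zero (mem_univ (u, w)) (by simp [f, huw, hb, hne])).symm
  rw [Finset.sum_congr rfl fun d _ => hprod d, sum_prod_adj, undirProb, if_pos ⟨hg, hs⟩,
    ← prod_before_eq_prod_lt (run g).visited (fun i j => if g i j then p else 1 - p)
      (fun i j => by rw [hs]), Finset.prod_filter]
  refine Finset.prod_congr rfl fun x _ => ?_
  by_cases hx : x.1 = x.2
  · simp [f, hx, Before.irrefl]
  · by_cases hb : Before (run g).visited x.1 x.2 <;> cases hgx : g x.1 x.2 <;>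
      simp [f, hx, hb, hgx]

end DFSExploration

open DFSExploration in
/-- For every `n` and `p ∈ [0,1]`, the forward depth-first forest of
`G⃗(n,p)` has the same distribution as the depth-first forest of `G(n,p)`:
for every possible forest `F`, the probability that `F_{G⃗(n,p)} = F` equals the
probability that `F_{G(n,p)} = F`. -/
theorem forward_dfs_forest_eq_distribution
    (n : ℕ) (p : ℝ) (hp0 : 0 ≤ p) (hp1 : p ≤ 1)
    (F : List (Fin n × Fin n)) :
    ∑ d : Fin n → Fin n → Bool, (if dfsForest d = F then dirProb n p d else 0)
      = ∑ g : Fin n → Fin n → Bool, (if dfsForest g = F then undirProb n p g else 0) := by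
  have hund : ∀ g : Fin n → Fin n → Bool, (if dfsForest g = F then undirProb n p g else 0)
      = ∑ d : Fin n → Fin n → Bool,
        if g = symmetrize d then (if dfsForest d = F then dirProb n p d else 0) else 0 := by
    intro g
    by_cases hgs : (∀ i, g i i = false) ∧ (∀ i j, g i j = g j i)
    · have hterm : ∀ d : Fin n → Fin n → Bool,
          (if g = symmetrize d then (if dfsForest d = F then dirProb n p d else 0) else 0)
            = if dfsForest g = F then (if Agree g d then dirProb n p d else 0) else 0 := by
        intro d
        by_cases hd : ∀ i, d i i = false
        · simp only [agree_iff_eq_symmetrize hgs.1 hgs.2 hd]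
          by_cases hgd : g = symmetrize d
          · have : dfsForest g = dfsForest d := by rw [dfsForest, hgd, run_symmetrize, dfsForest]
            rw [this, if_pos hgd, if_pos hgd]
          · simp [hgd]
        · simp [dirProb, hd]
      rw [Finset.sum_congr rfl fun d _ => hterm d, ← sum_agree_dirProb p hgs.1 hgs.2]
      split_ifs <;> simp
    · rw [undirProb, if_neg hgs, ite_self]
      refine (Finset.sum_eq_zero fun d _ => ?_).symm
      by_cases hgd : g = symmetrize d
      · have hd : ¬ ∀ i, d i i = false := fun hd =>
          hgs ⟨fun i => by simp [hgd, symmetrize, hd], fun i j => by rw [hgd, symmetrize_comm]⟩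
        simp [dirProb, hd]
      · rw [if_neg hgd]
  rw [Finset.sum_congr rfl fun g _ => hund g, Finset.sum_comm]
  simp
end

section
/- For every n ∈ ℕ and p ∈ [0,1], the undirected graph (G⃗(n,p))_fwd whose edge set consists of the forward edges of G⃗(n,p) (with respect to its forward depth-first exploration) has the same distribution as the Erdős–Rényi random graph G(n,p). -/
/-!
The forward depth-first forest of the random directed graph `G⃗(n,p)` has the same
distribution as the depth-first forest of the Erdős–Rényi graph `G(n,p)`.

Graphs on `[n] = {1,…,n}` are encoded as functions `Fin n → Fin n → Bool` (adjacency,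
`d u w = true` meaning there is a (directed) edge from `u` to `w`); vertex `1` corresponds
to `(0 : Fin n)` and the increasing order on labels is the order on `Fin n`.
-/

open Finset

namespace DFSExploration

/-- The position of a vertex in the depth-first order `v₀, v₁, …, v_{n-1}`. -/
def dfsPos {n : ℕ} (adj : Fin n → Fin n → Bool) (v : Fin n) : ℕ :=
  (run adj).visited.findIdx (fun w => decide (w = v))

/-- The undirected graph `(G⃗)_fwd` whose edges are the forward edges of the directed
graph `d`, i.e. the edges of `d` which are increasing for the depth-first order of `d`. -/
def fwdGraph {n : ℕ} (d : Fin n → Fin n → Bool) : Fin n → Fin n → Bool :=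
  fun u w => (d u w && decide (dfsPos d u < dfsPos d w))
    || (d w u && decide (dfsPos d w < dfsPos d u))

end DFSExploration

namespace DFSExploration

variable {n : ℕ}

/-- The state in which the exploration starts. -/
def initState (n : ℕ) : State n := ⟨(List.finRange n).take 1, [], []⟩

lemma visited_isPrefix_step (adj : Fin n → Fin n → Bool) (s : State n) :
    s.visited <+: (step adj s).visited := by
  unfold step
  split
  · exact List.prefix_rfl
  · exact List.prefix_append _ _

lemma visited_isPrefix_iterate (adj : Fin n → Fin n → Bool) (s : State n) (k : ℕ) :
    s.visited <+: ((step adj)^[k] s).visited := by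
  induction k with
  | zero => exact List.prefix_rfl
  | succ k ih =>
    rw [Function.iterate_succ_apply']
    exact ih.trans (visited_isPrefix_step adj _)

lemma findIdx_lt_findIdx_of_mem_of_notMem {α : Type*} [DecidableEq α] {l L : List α} {v w : α}
    (h : l <+: L) (hv : v ∈ l) (hw : w ∉ l) :
    L.findIdx (fun x => decide (x = v)) < L.findIdx (fun x => decide (x = w)) := by
  obtain ⟨t, rfl⟩ := h
  have hv' : l.findIdx (fun x => decide (x = v)) < l.length :=
    List.findIdx_lt_length_of_exists ⟨v, hv, by simp⟩
  have hw' : ¬ l.findIdx (fun x => decide (x = w)) < l.length := by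
    rw [List.findIdx_lt_length]
    rintro ⟨x, hx, hxw⟩
    exact hw (of_decide_eq_true hxw ▸ hx)
  rw [List.findIdx_append, List.findIdx_append, if_pos hv', if_neg hw']
  omega

/-- Two graphs have the same exploration as soon as they agree on the pairs which are
increasing for the depth-first order of the first one. -/
lemma run_eq_of_agree {adj adj' : Fin n → Fin n → Bool}
    (h : ∀ u w, dfsPos adj u < dfsPos adj w → adj u w = adj' u w) :
    run adj = run adj' := by
  have key : ∀ k ≤ n, (step adj)^[k] (initState n) = (step adj')^[k] (initState n) := by
    intro k
    induction k with
    | zero => intro _; rfl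
    | succ k ih =>
      intro hk
      rw [Function.iterate_succ_apply', Function.iterate_succ_apply', ← ih (by omega)]
      have hpre : (step adj ((step adj)^[k] (initState n))).visited <+: (run adj).visited := by
        have h1 := visited_isPrefix_iterate adj ((step adj)^[k + 1] (initState n)) (n - (k + 1))
        rw [← Function.iterate_add_apply, Nat.sub_add_cancel hk,
          Function.iterate_succ_apply'] at h1
        exact h1
      generalize (step adj)^[k] (initState n) = s at hpre
      unfold step at hpre ⊢
      rcases hs : s.stack with _ | ⟨v, rest⟩
      · rfl
      · simp only [hs] at hpre ⊢
        have hns : (List.finRange n).filter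
              (fun w => adj v w && !(decide (w ∈ v :: rest)) && !(decide (w ∈ s.visited)))
            = (List.finRange n).filter
              (fun w => adj' v w && !(decide (w ∈ v :: rest)) && !(decide (w ∈ s.visited))) := by
          refine List.filter_congr fun w _ => ?_
          by_cases hw1 : w ∈ v :: rest
          · simp [hw1]
          by_cases hw2 : w ∈ s.visited
          · simp [hw2]
          rw [h v w (findIdx_lt_findIdx_of_mem_of_notMem hpre (by simp) ?_)]
          simp only [List.mem_append, List.mem_singleton, not_or]
          exact ⟨hw2, fun hwv => hw1 (by simp [hwv])⟩
        rw [hns]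
  exact key n le_rfl

/-- The invariant of the exploration: no vertex is repeated among the open and explored
ones, and the stack is empty only when every vertex has been explored. -/
structure State.Valid (s : State n) : Prop where
  nodup : (s.stack ++ s.visited).Nodup
  complete : s.stack = [] → ∀ w, w ∈ s.visited

lemma initState_valid : (initState n).Valid := by
  constructor
  · simpa [initState] using (List.nodup_finRange n).sublist (List.take_sublist 1 _)
  · intro h w
    have : n = 0 := by simpa [initState] using h
    subst this
    exact w.elim0

lemma State.Valid.step {s : State n} (hs : s.Valid) (adj : Fin n → Fin n → Bool) :
    (step adj s).Valid := by
  obtain ⟨hnd, hc⟩ := hs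
  unfold DFSExploration.step
  rcases hst : s.stack with _ | ⟨v, rest⟩
  · exact ⟨hnd, hc⟩
  rw [hst] at hnd
  simp only [List.cons_append, List.nodup_cons, List.nodup_append, List.mem_append,
    not_or] at hnd
  have hF := List.nodup_finRange n
  constructor
  · dsimp only
    split_ifs with he
    · rw [List.nodup_append]
      refine ⟨(hF.filter _).sublist (List.take_sublist 1 _), ?_, ?_⟩
      · simp only [List.nodup_append]
        grind
      · intro a ha b hb
        have := List.mem_of_mem_take ha
        grind
    · simp only [List.nodup_append]
      refine ⟨⟨hF.filter _, ?_, ?_⟩, ?_, ?_⟩ <;> grind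
  · dsimp only
    split_ifs with he
    · intro h w
      simp only [List.take_eq_nil_iff, one_ne_zero, false_or, List.filter_eq_nil_iff] at h
      simpa [or_iff_not_imp_left] using h w (List.mem_finRange w)
    · intro h
      exact absurd (List.isEmpty_iff.mpr h) he

lemma iterate_valid (adj : Fin n → Fin n → Bool) (k : ℕ) :
    ((step adj)^[k] (initState n)).Valid := by
  induction k with
  | zero => exact initState_valid
  | succ k ih =>
    rw [Function.iterate_succ_apply']
    exact ih.step adj

lemma mem_visited_run (adj : Fin n → Fin n → Bool) (w : Fin n) : w ∈ (run adj).visited := by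
  have key : ∀ k, (∀ w, w ∈ ((step adj)^[k] (initState n)).visited) ∨
      ((step adj)^[k] (initState n)).visited.length = k := by
    intro k
    induction k with
    | zero => right; rfl
    | succ k ih =>
      rw [Function.iterate_succ_apply']
      have hv := iterate_valid adj k
      generalize (step adj)^[k] (initState n) = s at ih hv
      rcases ih with ih | ih
      · exact .inl fun w => (visited_isPrefix_step adj s).subset (ih w)
      · rcases hst : s.stack with _ | ⟨v, rest⟩
        · exact .inl fun w => (visited_isPrefix_step adj s).subset (hv.complete hst w)
        · right
          simp [step, hst, ih]
  rcases key n with h | h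
  · exact h w
  · have hnd := (List.nodup_append.mp (iterate_valid adj n).nodup).2.1
    have huniv : ((step adj)^[n] (initState n)).visited.toFinset = univ := by
      rw [← Finset.card_eq_iff_eq_univ, List.toFinset_card_of_nodup hnd, h, Fintype.card_fin]
    exact List.mem_toFinset.mp (huniv ▸ mem_univ w)

lemma dfsPos_injective (adj : Fin n → Fin n → Bool) : Function.Injective (dfsPos adj) := by
  have key : ∀ v, (run adj).visited[dfsPos adj v]? = some v := by
    intro v
    have hlt : dfsPos adj v < (run adj).visited.length :=
      List.findIdx_lt_length_of_exists ⟨v, mem_visited_run adj v, by simp⟩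
    rw [List.getElem?_eq_getElem hlt]
    exact congrArg some (of_decide_eq_true (List.findIdx_getElem (w := hlt)))
  intro v w h
  exact Option.some_injective _ (by rw [← key v, ← key w, h])

lemma fwdGraph_self (d : Fin n → Fin n → Bool) (i : Fin n) : fwdGraph d i i = false := by
  simp [fwdGraph]

lemma fwdGraph_comm (d : Fin n → Fin n → Bool) (i j : Fin n) :
    fwdGraph d i j = fwdGraph d j i := Bool.or_comm _ _

/-- The forward edges of `d` form the graph `g` exactly when `d` agrees with `g` on the pairs
increasing for the depth-first order of `g`. -/
lemma fwdGraph_eq_iff {d g : Fin n → Fin n → Bool} (hirr : ∀ i, g i i = false)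
    (hsymm : ∀ i j, g i j = g j i) :
    fwdGraph d = g ↔ ∀ u w, dfsPos g u < dfsPos g w → d u w = g u w := by
  constructor
  · rintro rfl
    have hag : ∀ u w, dfsPos d u < dfsPos d w → d u w = fwdGraph d u w := by
      intro u w h
      simp [fwdGraph, h, h.not_gt]
    have hpos : dfsPos (fwdGraph d) = dfsPos d := by
      funext v
      rw [dfsPos, dfsPos, run_eq_of_agree hag]
    rwa [hpos]
  · intro h
    have hpos : dfsPos d = dfsPos g := by
      funext v
      rw [dfsPos, dfsPos, run_eq_of_agree fun u w huw => (h u w huw).symm]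
    funext u w
    rcases lt_trichotomy (dfsPos g u) (dfsPos g w) with huw | huw | huw
    · simp [fwdGraph, hpos, huw, huw.not_gt, h u w huw]
    · rw [dfsPos_injective g huw, fwdGraph_self, hirr]
    · simp [fwdGraph, hpos, huw, huw.not_gt, h w u huw, hsymm u w]

/-- The contribution of the ordered pair `x`, in state `b`, to the probability that the
forward graph equals `g`. -/
noncomputable def pairWeight (p : ℝ) (g : Fin n → Fin n → Bool) (x : Fin n × Fin n)
    (b : Bool) : ℝ :=
  if x.1 = x.2 then (if b then 0 else 1)
  else if dfsPos g x.1 < dfsPos g x.2 ∧ b ≠ g x.1 x.2 then 0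
  else if b then p else 1 - p

lemma ite_fwdGraph_eq_prod (p : ℝ) {d g : Fin n → Fin n → Bool} (hirr : ∀ i, g i i = false)
    (hsymm : ∀ i j, g i j = g j i) :
    (if fwdGraph d = g then dirProb n p d else 0)
      = ∏ x : Fin n × Fin n, pairWeight p g x (d x.1 x.2) := by
  simp only [fwdGraph_eq_iff hirr hsymm, dirProb]
  split_ifs with h hd
  · rw [Finset.prod_filter]
    refine Finset.prod_congr rfl fun x _ => ?_
    by_cases hx : x.1 = x.2
    · have := hd x.2
      simp [pairWeight, hx, this]
    · have : ¬ (dfsPos g x.1 < dfsPos g x.2 ∧ d x.1 x.2 ≠ g x.1 x.2) :=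
        fun hc => hc.2 (h _ _ hc.1)
      rw [pairWeight, if_pos hx, if_neg hx, if_neg this]
  · push Not at hd
    obtain ⟨i, hi⟩ := hd
    refine (Finset.prod_eq_zero (mem_univ (i, i)) ?_).symm
    simpa [pairWeight] using hi
  · push Not at h
    obtain ⟨u, w, huw, hne⟩ := h
    refine (Finset.prod_eq_zero (mem_univ (u, w)) ?_).symm
    have : u ≠ w := fun e => huw.ne (by rw [e])
    simp [pairWeight, this, huw, hne]

lemma sum_pairWeight (p : ℝ) (g : Fin n → Fin n → Bool) (x : Fin n × Fin n) :
    ∑ b, pairWeight p g x b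
      = if dfsPos g x.1 < dfsPos g x.2 then (if g x.1 x.2 then p else 1 - p) else 1 := by
  by_cases hx : x.1 = x.2
  · simp [pairWeight, hx]
  · by_cases hp : dfsPos g x.1 < dfsPos g x.2 <;> cases hg : g x.1 x.2 <;>
      simp [pairWeight, hx, hp, hg]

/-- A symmetric function has the same product over the pairs increasing for any two
linear orders, one of them being given by an injective position function. -/
lemma prod_filter_pos_lt {pos : Fin n → ℕ} (hpos : Function.Injective pos)
    {f : Fin n → Fin n → ℝ} (hf : ∀ i j, f i j = f j i) :
    ∏ x ∈ univ.filter (fun x : Fin n × Fin n => pos x.1 < pos x.2), f x.1 x.2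
      = ∏ x ∈ univ.filter (fun x : Fin n × Fin n => x.1 < x.2), f x.1 x.2 := by
  refine Finset.prod_bij' (fun x _ => if x.1 < x.2 then x else x.swap)
    (fun x _ => if pos x.1 < pos x.2 then x else x.swap) ?_ ?_ ?_ ?_ ?_
  · rintro ⟨a, b⟩ h
    simp only [mem_filter, mem_univ, true_and] at h ⊢
    split_ifs with hab
    · exact hab
    · exact lt_of_le_of_ne (not_lt.mp hab) fun e => h.ne (congrArg pos e.symm)
  · rintro ⟨a, b⟩ h
    simp only [mem_filter, mem_univ, true_and] at h ⊢
    split_ifs with hab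
    · exact hab
    · exact lt_of_le_of_ne (not_lt.mp hab) fun e => h.ne (hpos e).symm
  · rintro ⟨a, b⟩ h
    simp only [mem_filter, mem_univ, true_and] at h
    by_cases hab : a < b <;> simp [hab, h, h.not_gt]
  · rintro ⟨a, b⟩ h
    simp only [mem_filter, mem_univ, true_and] at h
    by_cases hab : pos a < pos b <;> simp [hab, h, h.not_gt]
  · rintro ⟨a, b⟩ _
    by_cases hab : a < b
    · simp [hab]
    · simpa [hab] using hf a b

end DFSExploration

open DFSExploration in
/-- For every `n` and `p ∈ [0,1]`, the undirected graph `(G⃗(n,p))_fwd`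
consisting of the forward edges of `G⃗(n,p)` has the same distribution as the
Erdős–Rényi graph `G(n,p)`: for every undirected graph `g`, the probability that
`(G⃗(n,p))_fwd = g` equals the probability that `G(n,p) = g`. -/
theorem forward_edges_eq_erdos_renyi_distribution
    (n : ℕ) (p : ℝ) (hp0 : 0 ≤ p) (hp1 : p ≤ 1)
    (g : Fin n → Fin n → Bool) :
    ∑ d : Fin n → Fin n → Bool, (if fwdGraph d = g then dirProb n p d else 0)
      = undirProb n p g := by
  by_cases hg : (∀ i, g i i = false) ∧ (∀ i j, g i j = g j i)
  · obtain ⟨hirr, hsymm⟩ := hg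
    calc _ = ∑ d : Fin n → Fin n → Bool, ∏ x : Fin n × Fin n, pairWeight p g x (d x.1 x.2) :=
          Finset.sum_congr rfl fun d _ => ite_fwdGraph_eq_prod p hirr hsymm
      _ = ∑ e : Fin n × Fin n → Bool, ∏ x, pairWeight p g x (e x) :=
          ((Equiv.curry (Fin n) (Fin n) Bool).sum_comp _).symm
      _ = ∏ x : Fin n × Fin n, ∑ b, pairWeight p g x b := by
          rw [Finset.prod_univ_sum, Fintype.piFinset_univ]
      _ = undirProb n p g := by
          simp only [sum_pairWeight]
          rw [← Finset.prod_filter, prod_filter_pos_lt (dfsPos_injective g)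
            (f := fun i j => if g i j then p else 1 - p) fun i j => by rw [hsymm i j]]
          rw [undirProb, if_pos ⟨hirr, hsymm⟩]
  · rw [undirProb, if_neg hg]
    refine Finset.sum_eq_zero fun d _ => if_neg ?_
    rintro rfl
    exact hg ⟨fwdGraph_self d, fwdGraph_comm d⟩
end

section
/- Let T be a finite rooted plane tree with root ρ and B a set of back edges on T, with marked subset ((x_i,y_i), i ≤ N) as defined. Let X be the directed graph obtained from T (edges directed away from ρ) by adding all edges of B, and let X* be the subgraph of X obtained by removing every element of B which is not of the form (x_i,y_i) for some 1 ≤ i ≤ N. Then X and X* have the same strongly connected components. -/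
/-!
A finite rooted plane tree `T` is encoded with vertex set `Fin n`, the vertices being
labelled in depth-first (planar) order: the root is `0`, each non-root vertex `v` has a
parent `par v < v`, and the set of descendants of any vertex is an interval for the order
(this "interval" property characterises depth-first orders of plane trees).

Back edges are pairs `(x, y)` with `y < x` (i.e. `y` strictly before `x` in the planar
order).  The marked subset of a set `B` of back edges is produced by the inductive
procedure of the paper: repeatedly mark the lexicographically smallest unmarked back edge
`(x, y)` of `B` such that `y` lies on the union of the paths from the root to `x` and to
the tails of the previously marked edges (for the empty marked set this says that `y` is
an ancestor of `x`, i.e. the first marked edge is the first ancestral back edge of `B`).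
-/

open Finset
open scoped Classical

namespace PlaneTreeMarking

/-- `u` is an ancestor of `v` (inclusively) in the tree with parent map `par`. -/
def Anc {n : ℕ} (par : Fin n → Fin n) (u v : Fin n) : Prop :=
  ∃ k : ℕ, par^[k] v = u

/-- One step of the marking procedure: among the unmarked elements `(x, y)` of `B` such
that `y` lies on the union of the paths from the root to `x` and to the tails of the
already marked edges, mark the lexicographically smallest one (if there is any). -/
noncomputable def markStep {n : ℕ} (par : Fin n → Fin n) (B : Finset (Fin n × Fin n))
    (marked : Finset (Fin n × Fin n)) : Finset (Fin n × Fin n) :=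
  let cands := (B \ marked).filter
    (fun x => Anc par x.2 x.1 ∨ ∃ y ∈ marked, Anc par x.2 y.1)
  if h : cands.Nonempty then
    marked ∪ cands.filter
      (fun x => (toLex x : Lex (Fin n × Fin n)) =
        (cands.image (fun z => (toLex z : Lex (Fin n × Fin n)))).min' (h.image _))
  else marked

/-- The marked subset `((xᵢ, yᵢ), i ≤ N)` of the set `B` of back edges. -/
noncomputable def markedEdges {n : ℕ} (par : Fin n → Fin n)
    (B : Finset (Fin n × Fin n)) : Finset (Fin n × Fin n) :=
  (markStep par B)^[B.card] ∅

/-- The edge relation of the tree with parent map `par`, rooted at `root`, with edges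
directed away from the root. -/
def TreeEdge {n : ℕ} (par : Fin n → Fin n) (root : Fin n) (a b : Fin n) : Prop :=
  b ≠ root ∧ par b = a

/-- Reachability by a directed path. -/
def Reaches {n : ℕ} (E : Fin n → Fin n → Prop) : Fin n → Fin n → Prop :=
  Relation.ReflTransGen E

/-- Two vertices lie in the same strongly connected component of the directed graph with
edge relation `E`. -/
def SameSCC {n : ℕ} (E : Fin n → Fin n → Prop) (u v : Fin n) : Prop :=
  Reaches E u v ∧ Reaches E v u

/-- The directed graphs `X` and `X'` (on the same vertex set) have the same strongly
connected components: they induce the same partition into strongly connected components,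
and each component carries the same edges in both. -/
def SameSCCs {n : ℕ} (E E' : Fin n → Fin n → Prop) : Prop :=
  (∀ u v, SameSCC E u v ↔ SameSCC E' u v) ∧
  (∀ u v, (E u v ∧ SameSCC E u v) ↔ (E' u v ∧ SameSCC E' u v))

theorem Anc.trans {n : ℕ} {par : Fin n → Fin n} {u v w : Fin n}
    (huv : Anc par u v) (hvw : Anc par v w) : Anc par u w := by
  obtain ⟨k, rfl⟩ := huv
  obtain ⟨l, rfl⟩ := hvw
  exact ⟨k + l, Function.iterate_add_apply par k l w⟩

/-- The back edges that the marking procedure may mark next. -/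
noncomputable def candidates {n : ℕ} (par : Fin n → Fin n) (B marked : Finset (Fin n × Fin n)) :
    Finset (Fin n × Fin n) :=
  (B \ marked).filter (fun x => Anc par x.2 x.1 ∨ ∃ y ∈ marked, Anc par x.2 y.1)

section Marking

variable {n : ℕ} {par : Fin n → Fin n} {B S : Finset (Fin n × Fin n)}

theorem subset_markStep : S ⊆ markStep par B S := by
  unfold markStep
  dsimp only
  split_ifs
  · exact subset_union_left
  · exact Subset.rfl

theorem markStep_subset (hS : S ⊆ B) : markStep par B S ⊆ B := by
  unfold markStep
  dsimp only
  split_ifs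
  · exact union_subset hS
      ((filter_subset _ _).trans ((filter_subset _ _).trans sdiff_subset))
  · exact hS

theorem markStep_eq_self (h : candidates par B S = ∅) : markStep par B S = S :=
  dif_neg (not_nonempty_iff_eq_empty.2 h)

theorem card_lt_card_markStep (h : (candidates par B S).Nonempty) :
    S.card < (markStep par B S).card := by
  refine card_lt_card ((ssubset_iff_of_subset subset_markStep).2 ?_)
  obtain ⟨z, hz, hzmin⟩ := mem_image.1 (min'_mem _ (h.image fun z => toLex z))
  refine ⟨z, ?_, (mem_sdiff.1 (mem_filter.1 hz).1).2⟩
  unfold markStep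
  dsimp only
  split_ifs with h'
  · exact mem_union_right _ (mem_filter.2 ⟨hz, hzmin⟩)
  · exact absurd h h'

theorem iterate_markStep_subset (k : ℕ) : (markStep par B)^[k] ∅ ⊆ B := by
  induction k with
  | zero => exact empty_subset B
  | succ k ih =>
    rw [Function.iterate_succ_apply']
    exact markStep_subset ih

theorem markedEdges_subset : markedEdges par B ⊆ B :=
  iterate_markStep_subset _

/-- The procedure has stopped after `B.card` steps. -/
theorem candidates_markedEdges : candidates par B (markedEdges par B) = ∅ := by
  have key (k : ℕ) : candidates par B ((markStep par B)^[k] ∅) = ∅ ∨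
      k ≤ ((markStep par B)^[k] ∅).card := by
    induction k with
    | zero => exact Or.inr (Nat.zero_le _)
    | succ k ih =>
      rw [Function.iterate_succ_apply']
      rcases eq_empty_or_nonempty (candidates par B ((markStep par B)^[k] ∅)) with h | h
      · rw [markStep_eq_self h]
        exact Or.inl h
      · have := card_lt_card_markStep h
        have := ih.resolve_left h.ne_empty
        right
        omega
  rcases key B.card with h | h
  · exact h
  · rw [markedEdges, eq_of_subset_of_card_le (iterate_markStep_subset _) h]
    simp [candidates]

theorem mem_markedEdges_of_anc {x y : Fin n} (hB : (x, y) ∈ B)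
    (h : Anc par y x ∨ ∃ e ∈ markedEdges par B, Anc par y e.1) :
    (x, y) ∈ markedEdges par B := by
  by_contra hM
  have hc : (x, y) ∈ candidates par B (markedEdges par B) :=
    mem_filter.2 ⟨mem_sdiff.2 ⟨hB, hM⟩, h⟩
  simp [candidates_markedEdges] at hc

/-- Everything reachable from the head `y` of an unmarked back edge is a descendant of the head
of an unmarked back edge which is either `y` or lies before `y` without being its ancestor. -/
theorem exists_unmarked_head_anc_of_reaches {root x y z : Fin n}
    (hplane : ∀ u v w : Fin n, u ≤ v → v ≤ w → Anc par u w → Anc par u v)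
    (hback : ∀ e ∈ B, e.2 < e.1) (hB : (x, y) ∈ B) (hM : (x, y) ∉ markedEdges par B)
    (hz : Reaches (fun a b => TreeEdge par root a b ∨ (a, b) ∈ B) y z) :
    ∃ a b, (a, b) ∈ B ∧ (a, b) ∉ markedEdges par B ∧ b ≤ y ∧ (b = y ∨ ¬ Anc par b y) ∧
      Anc par b z := by
  induction hz with
  | refl => exact ⟨x, y, hB, hM, le_rfl, Or.inl rfl, 0, rfl⟩
  | @tail z w _ hzw ih =>
    obtain ⟨a, b, hab, habM, hby, hor, hbz⟩ := ih
    rcases hzw with ⟨-, rfl⟩ | hzw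
    · exact ⟨a, b, hab, habM, hby, hor, hbz.trans ⟨1, rfl⟩⟩
    · have hzwM : (z, w) ∉ markedEdges par B := fun h =>
        habM (mem_markedEdges_of_anc hab (Or.inr ⟨_, h, hbz⟩))
      have hwz : ¬ Anc par w z := fun h => hzwM (mem_markedEdges_of_anc hzw (Or.inl h))
      rcases le_total b w with hbw | hwb
      · exact ⟨a, b, hab, habM, hby, hor, hplane _ _ _ hbw (hback _ hzw).le hbz⟩
      · refine ⟨z, w, hzw, hzwM, hwb.trans hby, Or.inr fun h => hwz ?_, 0, rfl⟩
        exact (hplane _ _ _ hwb hby h).trans hbz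

/-- A back edge lying on a directed cycle is marked. -/
theorem mem_markedEdges_of_reaches {root x y : Fin n}
    (hplane : ∀ u v w : Fin n, u ≤ v → v ≤ w → Anc par u w → Anc par u v)
    (hback : ∀ e ∈ B, e.2 < e.1) (hB : (x, y) ∈ B)
    (hyx : Reaches (fun a b => TreeEdge par root a b ∨ (a, b) ∈ B) y x) :
    (x, y) ∈ markedEdges par B := by
  by_contra hM
  obtain ⟨a, b, -, -, hby, hor, hbx⟩ :=
    exists_unmarked_head_anc_of_reaches hplane hback hB hM hyx
  rcases hor with rfl | hor
  · exact hM (mem_markedEdges_of_anc hB (Or.inl hbx))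
  · exact hor (hplane _ _ _ hby (hback _ hB).le hbx)

end Marking

/-- Removing edges that lie on no directed cycle preserves strongly connected components. -/
theorem sameSCCs_of_cycle_edges {n : ℕ} {E E' : Fin n → Fin n → Prop}
    (hle : ∀ u v, E' u v → E u v) (hcycle : ∀ u v, E u v → Reaches E v u → E' u v) :
    SameSCCs E E' := by
  have hreach {u v : Fin n} (huv : Reaches E u v) (hvu : Reaches E v u) : Reaches E' u v := by
    induction huv using Relation.ReflTransGen.head_induction_on with
    | refl => exact .refl
    | head huw hwv ih =>
      exact .head (hcycle _ _ huw (hwv.trans hvu)) (ih (hvu.tail huw))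
  have hscc (u v : Fin n) : SameSCC E u v ↔ SameSCC E' u v :=
    ⟨fun h => ⟨hreach h.1 h.2, hreach h.2 h.1⟩,
      fun h => ⟨Relation.ReflTransGen.mono hle _ _ h.1, Relation.ReflTransGen.mono hle _ _ h.2⟩⟩
  exact ⟨hscc, fun u v => ⟨fun h => ⟨hcycle u v h.1 h.2.2, (hscc u v).1 h.2⟩,
    fun h => ⟨hle u v h.1, (hscc u v).2 h.2⟩⟩⟩

end PlaneTreeMarking

open PlaneTreeMarking in
/-- Let `T` be a finite rooted plane tree (vertices labelled in planar,
i.e. depth-first, order) and `B` a set of back edges on `T`, with marked subset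
`((xᵢ, yᵢ), i ≤ N)`.  Let `X` be the directed graph obtained from `T` (edges directed
away from the root) by adding all edges of `B`, and let `X*` be the subgraph of `X`
obtained by removing every element of `B` which is not marked.  Then `X` and `X*` have
the same strongly connected components. -/
theorem marked_back_edges_same_scc
    (n : ℕ) (hn : 0 < n) (par : Fin n → Fin n)
    (hroot : par ⟨0, hn⟩ = ⟨0, hn⟩)
    (hpar : ∀ v : Fin n, v ≠ ⟨0, hn⟩ → par v < v)
    (hplane : ∀ u v w : Fin n, u ≤ v → v ≤ w → Anc par u w → Anc par u v)
    (B : Finset (Fin n × Fin n)) (hB : ∀ x ∈ B, x.2 < x.1) :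
    SameSCCs
      (fun a b => TreeEdge par ⟨0, hn⟩ a b ∨ (a, b) ∈ B)
      (fun a b => TreeEdge par ⟨0, hn⟩ a b ∨ (a, b) ∈ markedEdges par B) := by
  refine sameSCCs_of_cycle_edges (fun u v => Or.imp_right fun h => markedEdges_subset h) ?_
  rintro u v (huv | huv) hvu
  · exact Or.inl huv
  · exact Or.inr (mem_markedEdges_of_reaches hplane hB huv hvu)
end

section
/- Let X = (V,E,r,ℓ) and X′ = (V′,E′,r′,ℓ′) be metric directed multigraphs, each connected when viewed as a metric space. Then d_GH(X,X′) ≤ (1/2)·|E|·d_𝒢(X,X′), where d_GH denotes the Gromov–Hausdorff distance between the associated compact metric spaces. -/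
open scoped Classical ENNReal
open Finset

/-- A metric directed multigraph (MDM): finite sets `V` of vertices and `E` of edges,
each edge `e` having a tail, a head, and a strictly positive length. -/
structure MDM where
  V : Type
  E : Type
  [fintV : Fintype V]
  [fintE : Fintype E]
  tail : E → V
  head : E → V
  len : E → ℝ
  len_pos : ∀ e, 0 < len e

attribute [instance] MDM.fintV MDM.fintE

/-- A graph isomorphism between two MDMs: compatible bijections of the vertex and edge
sets, preserving tails and heads. -/
structure MDMIsom (X Y : MDM) where
  f : X.V ≃ Y.V
  g : X.E ≃ Y.E
  tail_eq : ∀ e, Y.tail (g e) = f (X.tail e)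
  head_eq : ∀ e, Y.head (g e) = f (X.head e)

/-- The distance `d_𝒢` between two MDMs: the infimum over graph isomorphisms of the
supremum over edges of the discrepancy of the lengths (`∞` if they are not isomorphic). -/
noncomputable def dMDM (X Y : MDM) : ℝ≥0∞ :=
  ⨅ φ : MDMIsom X Y, ⨆ e : X.E, ENNReal.ofReal |X.len e - Y.len (φ.g e)|

namespace MDM

/-- The set of lengths of walks (in the underlying undirected multigraph) from `u` to `w`. -/
def walkLengths (X : MDM) (u w : X.V) : Set ℝ :=
  {L | ∃ (k : ℕ) (vs : Fin (k+1) → X.V) (es : Fin k → X.E),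
    vs 0 = u ∧ vs (Fin.last k) = w ∧
    (∀ i : Fin k, (X.tail (es i) = vs i.castSucc ∧ X.head (es i) = vs i.succ) ∨
      (X.head (es i) = vs i.castSucc ∧ X.tail (es i) = vs i.succ)) ∧
    L = ∑ i, X.len (es i)}

/-- The shortest-path distance between two vertices of the metric realization. -/
noncomputable def vDist (X : MDM) (u w : X.V) : ℝ :=
  sInf (X.walkLengths u w)

/-- The points of the metric realization of an MDM: the vertices, together with the
interior points of the edges (a point at distance `t` from the tail along edge `e`,
`0 < t < len e`). -/
def Space (X : MDM) : Type :=
  X.V ⊕ {p : X.E × ℝ // 0 < p.2 ∧ p.2 < X.len p.1}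

/-- The distance from a point of the realization to a vertex. -/
noncomputable def ptVDist (X : MDM) : X.Space → X.V → ℝ
  | Sum.inl u, w => X.vDist u w
  | Sum.inr p, w =>
      min (p.1.2 + X.vDist (X.tail p.1.1) w) ((X.len p.1.1 - p.1.2) + X.vDist (X.head p.1.1) w)

/-- The shortest-path distance on the metric realization of an MDM. -/
noncomputable def spaceDist (X : MDM) : X.Space → X.Space → ℝ
  | Sum.inl u, y => X.ptVDist y u
  | Sum.inr p, Sum.inl w => X.ptVDist (Sum.inr p) w
  | Sum.inr p, Sum.inr q =>
      let viaVertex := min (p.1.2 + X.ptVDist (Sum.inr q) (X.tail p.1.1))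
        ((X.len p.1.1 - p.1.2) + X.ptVDist (Sum.inr q) (X.head p.1.1))
      if p.1.1 = q.1.1 then min viaVertex |p.1.2 - q.1.2| else viaVertex

end MDM

namespace MDM

/-- The edge `e` connects `u` and `v`, in one of the two directions. -/
def Joins (X : MDM) (e : X.E) (u v : X.V) : Prop :=
  (X.tail e = u ∧ X.head e = v) ∨ (X.head e = u ∧ X.tail e = v)

theorem Joins.symm {X : MDM} {e : X.E} {u v : X.V} (h : X.Joins e u v) : X.Joins e v u := by
  rcases h with ⟨h1, h2⟩ | ⟨h1, h2⟩
  · exact Or.inr ⟨h2, h1⟩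
  · exact Or.inl ⟨h2, h1⟩

/-- `X.Trail S u w` says that some walk from `u` to `w` uses exactly the edges in `S`,
each of them once. -/
inductive Trail (X : MDM) : Finset X.E → X.V → X.V → Prop
  | nil (u : X.V) : Trail X ∅ u u
  | cons {S : Finset X.E} {e : X.E} {u v w : X.V} (he : e ∉ S) (hj : X.Joins e u v)
      (h : Trail X S v w) : Trail X (insert e S) u w

namespace Trail

variable {X : MDM} {S : Finset X.E} {e : X.E} {u v w : X.V}

theorem snoc (h : X.Trail S u v) (he : e ∉ S) (hj : X.Joins e v w) :
    X.Trail (insert e S) u w := by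
  induction h with
  | nil u => exact .cons he hj (.nil w)
  | @cons S e' u v x he' hj' h ih =>
    rw [Finset.mem_insert, not_or] at he
    rw [Finset.insert_comm]
    refine .cons ?_ hj' (ih he.2 hj)
    rw [Finset.mem_insert, not_or]
    exact ⟨fun h => he.1 h.symm, he'⟩

theorem symm (h : X.Trail S u w) : X.Trail S w u := by
  induction h with
  | nil u => exact .nil u
  | cons he hj _ ih => exact ih.snoc he hj.symm

theorem exists_suffix (h : X.Trail S u w) (he : e ∈ S) :
    ∃ T ⊆ S, e ∉ T ∧ (X.Trail T (X.tail e) w ∨ X.Trail T (X.head e) w) := by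
  induction h with
  | nil u => simp at he
  | @cons S e' u v w he' hj h ih =>
    by_cases hee : e = e'
    · subst hee
      refine ⟨S, Finset.subset_insert _ _, he', ?_⟩
      rcases hj with ⟨-, rfl⟩ | ⟨-, rfl⟩
      · exact Or.inr h
      · exact Or.inl h
    · obtain ⟨T, hT, h1, h2⟩ := ih ((Finset.mem_insert.1 he).resolve_left hee)
      exact ⟨T, hT.trans (Finset.subset_insert _ _), h1, h2⟩

end Trail

theorem sum_len_add_le {X : MDM} {S T : Finset X.E} {e : X.E} (hT : T ⊆ S) (he : e ∈ S)
    (heT : e ∉ T) : X.len e + ∑ i ∈ T, X.len i ≤ ∑ i ∈ S, X.len i := by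
  rw [← Finset.sum_insert heT]
  exact Finset.sum_le_sum_of_subset_of_nonneg (Finset.insert_subset he hT)
    fun i _ _ => (X.len_pos i).le

theorem exists_trail_of_walk {X : MDM} {u w : X.V} {L : ℝ} (h : L ∈ X.walkLengths u w) :
    ∃ S, X.Trail S u w ∧ ∑ i ∈ S, X.len i ≤ L := by
  obtain ⟨k, vs, es, h0, hl, hj, rfl⟩ := h
  induction k generalizing u with
  | zero =>
    have : u = w := by rw [← h0, ← hl]; rfl
    subst this
    exact ⟨∅, .nil u, by simp⟩
  | succ k ih =>
    obtain ⟨S, hS, hL⟩ := ih (u := vs 1) (fun i => vs i.succ) (fun i => es i.succ) rfl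
      (by rw [← hl]; rfl) (fun i => hj i.succ)
    have h1 : X.Joins (es 0) u (vs 1) := by subst h0; exact hj 0
    rw [Fin.sum_univ_succ]
    have hp := X.len_pos (es 0)
    by_cases he : es 0 ∈ S
    · obtain ⟨T, hT, heT, ht⟩ := hS.exists_suffix he
      have hs := sum_len_add_le hT he heT
      have key : X.Trail T u w ∨ X.Trail T (vs 1) w := by
        rcases h1 with ⟨a, b⟩ | ⟨a, b⟩ <;> rw [a, b] at ht
        · exact ht
        · exact ht.symm
      rcases key with h | h
      · exact ⟨T, h, by linarith⟩
      · exact ⟨_, .cons heT h1 h, by rw [Finset.sum_insert heT]; linarith⟩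
    · exact ⟨_, .cons he h1 hS, by rw [Finset.sum_insert he]; linarith⟩

theorem walkLengths_nonneg {X : MDM} {u w : X.V} {L : ℝ} (h : L ∈ X.walkLengths u w) :
    0 ≤ L := by
  obtain ⟨k, vs, es, -, -, -, rfl⟩ := h
  exact Finset.sum_nonneg fun i _ => (X.len_pos _).le

theorem vDist_le_len {X : MDM} {e : X.E} {u v : X.V} (h : X.Joins e u v) :
    X.vDist u v ≤ X.len e := by
  refine csInf_le ⟨0, fun _ => walkLengths_nonneg⟩
    ⟨1, ![u, v], fun _ => e, rfl, rfl, fun i => ?_, by simp⟩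
  fin_cases i
  exact h

theorem exists_trail_sum_le_vDist {X : MDM} {u w : X.V} (hne : (X.walkLengths u w).Nonempty) :
    ∃ S, X.Trail S u w ∧ ∑ i ∈ S, X.len i ≤ X.vDist u w := by
  obtain ⟨L, hL⟩ := hne
  obtain ⟨S₀, hS₀, -⟩ := exists_trail_of_walk hL
  obtain ⟨S, hS, hmin⟩ := Finset.exists_min_image
    (Finset.univ.filter fun S => X.Trail S u w) (fun S => ∑ i ∈ S, X.len i)
    ⟨S₀, by simpa using hS₀⟩
  refine ⟨S, by simpa using hS, le_csInf ⟨L, hL⟩ fun M hM => ?_⟩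
  obtain ⟨T, hT, hTM⟩ := exists_trail_of_walk hM
  exact (hmin T (by simpa using hT)).trans hTM

/-- The interior points of the edges. -/
abbrev Interior (X : MDM) : Type := {p : X.E × ℝ // 0 < p.2 ∧ p.2 < X.len p.1}

/-- A vertex, as a point of the metric realization. -/
def vertex (X : MDM) (u : X.V) : X.Space := Sum.inl u

/-- An interior point of an edge, as a point of the metric realization. -/
def point (X : MDM) (p : X.Interior) : X.Space := Sum.inr p

/-- The vertex `u` is the end of the edge of `p` at distance `a` from `p` along this edge. -/
def IsEnd (X : MDM) (p : X.Interior) (u : X.V) (a : ℝ) : Prop :=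
  (a = p.1.2 ∧ u = X.tail p.1.1) ∨ (a = X.len p.1.1 - p.1.2 ∧ u = X.head p.1.1)

theorem IsEnd.bounds {X : MDM} {p : X.Interior} {u : X.V} {a : ℝ} (h : X.IsEnd p u a) :
    0 < a ∧ a < X.len p.1.1 := by
  have := p.2
  rcases h with ⟨rfl, -⟩ | ⟨rfl, -⟩ <;> constructor <;> linarith

/-- A trail from an end of the edge of `p` can be replaced by one avoiding this edge. -/
theorem IsEnd.exists_trail_avoiding {X : MDM} {p : X.Interior} {u w : X.V} {a : ℝ}
    {S : Finset X.E} (h : X.IsEnd p u a) (hS : X.Trail S u w) :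
    ∃ T ⊆ S, ∃ v b, p.1.1 ∉ T ∧ X.IsEnd p v b ∧ X.Trail T v w ∧
      b + ∑ i ∈ T, X.len i ≤ a + ∑ i ∈ S, X.len i := by
  by_cases he : p.1.1 ∈ S
  · obtain ⟨T, hT, heT, ht⟩ := hS.exists_suffix he
    have hs := sum_len_add_le hT he heT
    have ha := h.bounds
    rcases ht with ht | ht
    · have hb : X.IsEnd p _ _ := Or.inl ⟨rfl, rfl⟩
      have := hb.bounds
      exact ⟨T, hT, _, _, heT, hb, ht, by linarith⟩
    · have hb : X.IsEnd p _ _ := Or.inr ⟨rfl, rfl⟩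
      have := hb.bounds
      exact ⟨T, hT, _, _, heT, hb, ht, by linarith⟩
  · exact ⟨S, subset_rfl, u, a, he, h, hS, le_rfl⟩

theorem exists_isEnd_ptVDist_eq {X : MDM} (p : X.Interior) (w : X.V) :
    ∃ u a, X.IsEnd p u a ∧ X.ptVDist (X.point p) w = a + X.vDist u w := by
  rcases min_choice (p.1.2 + X.vDist (X.tail p.1.1) w)
    ((X.len p.1.1 - p.1.2) + X.vDist (X.head p.1.1) w) with h | h
  · exact ⟨_, _, Or.inl ⟨rfl, rfl⟩, h⟩
  · exact ⟨_, _, Or.inr ⟨rfl, rfl⟩, h⟩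

theorem spaceDist_point_point {X : MDM} (p q : X.Interior) :
    (p.1.1 = q.1.1 ∧ X.spaceDist (X.point p) (X.point q) = |p.1.2 - q.1.2|) ∨
      ∃ u a v b, X.IsEnd p u a ∧ X.IsEnd q v b ∧
        X.spaceDist (X.point p) (X.point q) = a + (b + X.vDist v u) := by
  have via : ∃ u a v b, X.IsEnd p u a ∧ X.IsEnd q v b ∧
      min (p.1.2 + X.ptVDist (X.point q) (X.tail p.1.1))
        ((X.len p.1.1 - p.1.2) + X.ptVDist (X.point q) (X.head p.1.1)) =
        a + (b + X.vDist v u) := by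
    rcases min_choice (p.1.2 + X.ptVDist (X.point q) (X.tail p.1.1))
      ((X.len p.1.1 - p.1.2) + X.ptVDist (X.point q) (X.head p.1.1)) with h | h
    · obtain ⟨v, b, hv, hb⟩ := exists_isEnd_ptVDist_eq q (X.tail p.1.1)
      exact ⟨_, _, v, b, Or.inl ⟨rfl, rfl⟩, hv, by rw [h, hb]⟩
    · obtain ⟨v, b, hv, hb⟩ := exists_isEnd_ptVDist_eq q (X.head p.1.1)
      exact ⟨_, _, v, b, Or.inr ⟨rfl, rfl⟩, hv, by rw [h, hb]⟩
  have hd : X.spaceDist (X.point p) (X.point q) =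
      if p.1.1 = q.1.1 then
        min (min (p.1.2 + X.ptVDist (X.point q) (X.tail p.1.1))
          ((X.len p.1.1 - p.1.2) + X.ptVDist (X.point q) (X.head p.1.1))) |p.1.2 - q.1.2|
      else min (p.1.2 + X.ptVDist (X.point q) (X.tail p.1.1))
          ((X.len p.1.1 - p.1.2) + X.ptVDist (X.point q) (X.head p.1.1)) := rfl
  rw [hd]
  split_ifs with he
  · rcases min_choice (min (p.1.2 + X.ptVDist (X.point q) (X.tail p.1.1))
      ((X.len p.1.1 - p.1.2) + X.ptVDist (X.point q) (X.head p.1.1))) |p.1.2 - q.1.2| with h | h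
    · rw [h]; exact Or.inr via
    · rw [h]; exact Or.inl ⟨he, rfl⟩
  · exact Or.inr via

section Metric

variable {X : MDM} [MetricSpace X.Space] (hX : ∀ x y : X.Space, dist x y = X.spaceDist x y)

include hX

theorem dist_vertex (u w : X.V) : dist (X.vertex u) (X.vertex w) = X.vDist w u := hX _ _

theorem dist_point_vertex_eq (p : X.Interior) (w : X.V) :
    dist (X.point p) (X.vertex w) = X.ptVDist (X.point p) w := hX _ _

theorem walkLengths_nonempty (u w : X.V) : (X.walkLengths u w).Nonempty := by
  by_contra hne
  have h0 : dist (X.vertex w) (X.vertex u) = 0 := by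
    rw [dist_vertex hX, vDist, Set.not_nonempty_iff_eq_empty.1 hne, Real.sInf_empty]
  have hwu : X.vertex w = X.vertex u := dist_eq_zero.1 h0
  have : w = u := Sum.inl_injective hwu
  subst this
  exact hne ⟨0, 0, fun _ => w, Fin.elim0, rfl, rfl, fun i => i.elim0, by simp⟩

theorem dist_vertex_le_len {e : X.E} {u v : X.V} (h : X.Joins e u v) :
    dist (X.vertex u) (X.vertex v) ≤ X.len e := by
  rw [dist_vertex hX]
  exact vDist_le_len h.symm

theorem vDist_self (u : X.V) : X.vDist u u = 0 := by
  rw [← dist_vertex hX, dist_self]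

theorem IsEnd.dist_le {p : X.Interior} {u : X.V} {a : ℝ} (h : X.IsEnd p u a) :
    dist (X.point p) (X.vertex u) ≤ a := by
  rw [dist_point_vertex_eq hX]
  rcases h with ⟨rfl, rfl⟩ | ⟨rfl, rfl⟩
  · refine (min_le_left _ _).trans ?_
    rw [vDist_self hX, add_zero]
  · refine (min_le_right _ _).trans ?_
    rw [vDist_self hX, add_zero]

theorem dist_point_le_abs {p q : X.Interior} (h : p.1.1 = q.1.1) :
    dist (X.point p) (X.point q) ≤ |p.1.2 - q.1.2| := by
  rw [hX]
  simp only [spaceDist, point, h, if_true]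
  exact min_le_right _ _

end Metric

end MDM

namespace MDMIsom

variable {X Y : MDM}

theorem map_joins (φ : MDMIsom X Y) {e : X.E} {u v : X.V} (h : X.Joins e u v) :
    Y.Joins (φ.g e) (φ.f u) (φ.f v) := by
  unfold MDM.Joins
  rw [φ.tail_eq, φ.head_eq]
  rcases h with ⟨rfl, rfl⟩ | ⟨rfl, rfl⟩
  · exact Or.inl ⟨rfl, rfl⟩
  · exact Or.inr ⟨rfl, rfl⟩

/-- The inverse graph isomorphism. -/
def symm (φ : MDMIsom X Y) : MDMIsom Y X where
  f := φ.f.symm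
  g := φ.g.symm
  tail_eq e := by rw [Equiv.eq_symm_apply, ← φ.tail_eq, Equiv.apply_symm_apply]
  head_eq e := by rw [Equiv.eq_symm_apply, ← φ.head_eq, Equiv.apply_symm_apply]

instance : Finite (MDMIsom X Y) := by
  refine Finite.of_injective (fun φ => (φ.f, φ.g)) ?_
  rintro ⟨f, g, _, _⟩ ⟨f', g', _, _⟩ h
  simp only [Prod.mk.injEq] at h
  obtain ⟨rfl, rfl⟩ := h
  rfl

/-- The ratio of the lengths of an edge and its image. -/
noncomputable def ratio (φ : MDMIsom X Y) (e : X.E) : ℝ := Y.len (φ.g e) / X.len e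

theorem ratio_pos (φ : MDMIsom X Y) (e : X.E) : 0 < φ.ratio e :=
  div_pos (Y.len_pos _) (X.len_pos _)

theorem len_mul_ratio (φ : MDMIsom X Y) (e : X.E) : X.len e * φ.ratio e = Y.len (φ.g e) :=
  mul_div_cancel₀ _ (X.len_pos e).ne'

theorem mul_ratio_le (φ : MDMIsom X Y) {e : X.E} {a c : ℝ} (h0 : 0 ≤ a) (h1 : a ≤ X.len e)
    (hc : |X.len e - Y.len (φ.g e)| ≤ c) : a * φ.ratio e ≤ a + c := by
  have hl := φ.len_mul_ratio e
  have hp := X.len_pos e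
  rw [abs_le] at hc
  have hc0 : 0 ≤ c := by linarith
  by_cases hr : φ.ratio e ≤ 1
  · nlinarith
  · push Not at hr
    nlinarith [mul_nonneg (sub_nonneg.2 h1) (sub_nonneg.2 hr.le)]

/-- The map on interior points that rescales every edge linearly. -/
noncomputable def interiorMap (φ : MDMIsom X Y) (p : X.Interior) : Y.Interior :=
  ⟨(φ.g p.1.1, p.1.2 * φ.ratio p.1.1), mul_pos p.2.1 (φ.ratio_pos _), by
    rw [← φ.len_mul_ratio]
    exact mul_lt_mul_of_pos_right p.2.2 (φ.ratio_pos _)⟩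

/-- The map between metric realizations that rescales every edge linearly. -/
noncomputable def spaceMap (φ : MDMIsom X Y) : X.Space → Y.Space :=
  Sum.map φ.f φ.interiorMap

theorem isEnd_map (φ : MDMIsom X Y) {p : X.Interior} {u : X.V} {a : ℝ} (h : X.IsEnd p u a) :
    Y.IsEnd (φ.interiorMap p) (φ.f u) (a * φ.ratio p.1.1) := by
  rcases h with ⟨rfl, rfl⟩ | ⟨rfl, rfl⟩
  · exact Or.inl ⟨rfl, (φ.tail_eq _).symm⟩
  · refine Or.inr ⟨?_, (φ.head_eq _).symm⟩
    rw [sub_mul, φ.len_mul_ratio]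
    rfl

theorem ratio_symm (φ : MDMIsom X Y) (e : X.E) :
    φ.symm.ratio (φ.g e) = (φ.ratio e)⁻¹ := by
  simp [ratio, symm]

theorem spaceMap_symm_spaceMap (φ : MDMIsom X Y) (x : X.Space) :
    φ.symm.spaceMap (φ.spaceMap x) = x := by
  rcases x with u | p
  · exact congrArg Sum.inl (φ.f.symm_apply_apply u)
  · refine congrArg Sum.inr (Subtype.ext (Prod.ext (φ.g.symm_apply_apply p.1.1) ?_))
    change p.1.2 * φ.ratio p.1.1 * φ.symm.ratio (φ.g p.1.1) = p.1.2
    rw [ratio_symm, mul_inv_cancel_right₀ (φ.ratio_pos _).ne']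

section Metric

variable [MetricSpace Y.Space]

theorem dist_le_sum_of_trail (hY : ∀ x y : Y.Space, dist x y = Y.spaceDist x y)
    (φ : MDMIsom X Y) {S : Finset X.E} {u w : X.V} (h : X.Trail S u w) :
    dist (Y.vertex (φ.f u)) (Y.vertex (φ.f w)) ≤ ∑ e ∈ S, Y.len (φ.g e) := by
  induction h with
  | nil u => simp
  | @cons S e u v w he hj _ ih =>
    rw [Finset.sum_insert he]
    exact (dist_triangle _ (Y.vertex (φ.f v)) _).trans
      (add_le_add (MDM.dist_vertex_le_len hY (φ.map_joins hj)) ih)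

variable (hY : ∀ x y : Y.Space, dist x y = Y.spaceDist x y)
  (φ : MDMIsom X Y) {c : ℝ} (hc0 : 0 ≤ c) (hc : ∀ e, |X.len e - Y.len (φ.g e)| ≤ c)

include hY hc in
theorem dist_vertex_le_of_trail {S : Finset X.E} {u w : X.V} (h : X.Trail S u w) :
    dist (Y.vertex (φ.f u)) (Y.vertex (φ.f w)) ≤ ∑ e ∈ S, X.len e + (S.card : ℝ) * c := by
  refine (φ.dist_le_sum_of_trail hY h).trans ?_
  rw [← nsmul_eq_mul, ← Finset.sum_const, ← Finset.sum_add_distrib]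
  refine Finset.sum_le_sum fun e _ => ?_
  have := (abs_le.1 (hc e)).1
  linarith

variable [MetricSpace X.Space] (hX : ∀ x y : X.Space, dist x y = X.spaceDist x y)

include hX hY hc0 hc in
theorem dist_vertex_vertex_le (u w : X.V) :
    dist (Y.vertex (φ.f u)) (Y.vertex (φ.f w)) ≤
      dist (X.vertex u) (X.vertex w) + (Fintype.card X.E : ℝ) * c := by
  obtain ⟨S, hS, hl⟩ := MDM.exists_trail_sum_le_vDist (MDM.walkLengths_nonempty hX w u)
  rw [MDM.dist_vertex hX]
  have h1 := φ.dist_vertex_le_of_trail hY hc hS.symm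
  have h2 : (S.card : ℝ) ≤ Fintype.card X.E := by exact_mod_cast S.card_le_univ
  have h3 := mul_le_mul_of_nonneg_right h2 hc0
  linarith

include hX hY hc0 hc in
theorem dist_point_vertex_le (p : X.Interior) (w : X.V) :
    dist (Y.point (φ.interiorMap p)) (Y.vertex (φ.f w)) ≤
      dist (X.point p) (X.vertex w) + (Fintype.card X.E : ℝ) * c := by
  obtain ⟨u, a, hu, hd⟩ := MDM.exists_isEnd_ptVDist_eq p w
  obtain ⟨S, hS, hl⟩ := MDM.exists_trail_sum_le_vDist (MDM.walkLengths_nonempty hX u w)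
  obtain ⟨T, -, v, b, heT, hv, hT, hTS⟩ := hu.exists_trail_avoiding hS
  rw [MDM.dist_point_vertex_eq hX, hd]
  have h1 := φ.dist_vertex_le_of_trail hY hc hT
  have h2 := (φ.isEnd_map hv).dist_le hY
  have h3 := φ.mul_ratio_le hv.bounds.1.le hv.bounds.2.le (hc _)
  have h4 := dist_triangle (Y.point (φ.interiorMap p)) (Y.vertex (φ.f v)) (Y.vertex (φ.f w))
  have h5 : ((T.card + 1 : ℕ) : ℝ) ≤ Fintype.card X.E := by
    rw [← Finset.card_insert_of_notMem heT]
    exact_mod_cast Finset.card_le_univ _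
  have h6 := mul_le_mul_of_nonneg_right h5 hc0
  push_cast at h6
  linarith

include hX hY hc0 hc in
theorem dist_point_point_le_of_ne (p q : X.Interior) (hpq : p.1.1 ≠ q.1.1) :
    dist (Y.point (φ.interiorMap p)) (Y.point (φ.interiorMap q)) ≤
      dist (X.point p) (X.point q) + (Fintype.card X.E : ℝ) * c := by
  rcases MDM.spaceDist_point_point p q with ⟨h, -⟩ | ⟨u, a, v, b, hu, hv, hd⟩
  · exact absurd h hpq
  obtain ⟨S, hS, hl⟩ := MDM.exists_trail_sum_le_vDist (MDM.walkLengths_nonempty hX v u)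
  obtain ⟨T, -, v', b', hqT, hv', hT, hTS⟩ := hv.exists_trail_avoiding hS
  obtain ⟨R, hRT, u', a', hpR, hu', hR, hRle⟩ := hu.exists_trail_avoiding hT.symm
  rw [hX, hd]
  have h1 := φ.dist_vertex_le_of_trail hY hc hR
  have h2 := (φ.isEnd_map hu').dist_le hY
  have h2' := (φ.isEnd_map hv').dist_le hY
  have h3 := φ.mul_ratio_le hu'.bounds.1.le hu'.bounds.2.le (hc _)
  have h3' := φ.mul_ratio_le hv'.bounds.1.le hv'.bounds.2.le (hc _)
  have h4 := dist_triangle4 (Y.point (φ.interiorMap p)) (Y.vertex (φ.f u'))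
    (Y.vertex (φ.f v')) (Y.point (φ.interiorMap q))
  rw [dist_comm (Y.vertex (φ.f v'))] at h4
  have hqR : q.1.1 ∉ R := fun h => hqT (hRT h)
  have h5 : ((R.card + 1 + 1 : ℕ) : ℝ) ≤ Fintype.card X.E := by
    rw [← Finset.card_insert_of_notMem hqR, ← Finset.card_insert_of_notMem
      (a := p.1.1) (by simp [hpq, hpR])]
    exact_mod_cast Finset.card_le_univ _
  have h6 := mul_le_mul_of_nonneg_right h5 hc0
  push_cast at h6
  linarith

include hX hY hc0 hc in
theorem dist_point_point_le_of_eq (p q : X.Interior) (hpq : p.1.1 = q.1.1)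
    (hle : p.1.2 ≤ q.1.2) :
    dist (Y.point (φ.interiorMap p)) (Y.point (φ.interiorMap q)) ≤
      dist (X.point p) (X.point q) + (Fintype.card X.E : ℝ) * c := by
  have hp := p.2
  have hq := q.2
  have hratio : φ.ratio q.1.1 = φ.ratio p.1.1 := by rw [hpq]
  have hlen : X.len q.1.1 = X.len p.1.1 := by rw [hpq]
  by_cases hshort : q.1.2 - p.1.2 ≤ dist (X.point p) (X.point q)
  · have h1 : dist (Y.point (φ.interiorMap p)) (Y.point (φ.interiorMap q)) ≤
        (q.1.2 - p.1.2) * φ.ratio p.1.1 := by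
      refine (MDM.dist_point_le_abs hY (congrArg φ.g hpq)).trans_eq ?_
      change |p.1.2 * φ.ratio p.1.1 - q.1.2 * φ.ratio q.1.1| = _
      rw [hratio, ← sub_mul, abs_mul, abs_of_pos (φ.ratio_pos _), abs_sub_comm,
        abs_of_nonneg (sub_nonneg.2 hle)]
    have h2 := φ.mul_ratio_le (sub_nonneg.2 hle) (by linarith) (hc p.1.1)
    have h3 : ((1 : ℕ) : ℝ) ≤ Fintype.card X.E := by
      exact_mod_cast Fintype.card_pos_iff.2 ⟨p.1.1⟩
    have h4 := mul_le_mul_of_nonneg_right h3 hc0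
    push_cast at h4
    linarith
  rw [hX] at hshort ⊢
  push Not at hshort
  rcases MDM.spaceDist_point_point p q with ⟨-, h⟩ | ⟨u, a, v, b, hu, hv, hd⟩
  · rw [h, abs_sub_comm] at hshort
    exact absurd (le_abs_self _) hshort.not_ge
  obtain ⟨S, hS, hl⟩ := MDM.exists_trail_sum_le_vDist (MDM.walkLengths_nonempty hX v u)
  have hS0 : 0 ≤ ∑ e ∈ S, X.len e := Finset.sum_nonneg fun e _ => (X.len_pos e).le
  have ha := hu.bounds
  have hb := hv.bounds
  have hpS : p.1.1 ∉ S := fun h => by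
    have := MDM.sum_len_add_le (Finset.empty_subset S) h (by simp)
    rw [Finset.sum_empty] at this
    linarith
  have ha' : a = p.1.2 := by
    rcases hu with ⟨h, -⟩ | ⟨h, -⟩
    · exact h
    · linarith
  have hb' : b = X.len q.1.1 - q.1.2 := by
    rcases hv with ⟨h, -⟩ | ⟨h, -⟩
    · linarith
    · exact h
  have h1 := φ.dist_vertex_le_of_trail hY hc hS.symm
  have h2 := (φ.isEnd_map hu).dist_le hY
  have h2' := (φ.isEnd_map hv).dist_le hY
  have h3 := φ.mul_ratio_le (a := a + b) (by linarith) (by linarith) (hc p.1.1)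
  rw [add_mul] at h3
  rw [hratio] at h2'
  have h4 := dist_triangle4 (Y.point (φ.interiorMap p)) (Y.vertex (φ.f u))
    (Y.vertex (φ.f v)) (Y.point (φ.interiorMap q))
  rw [dist_comm (Y.vertex (φ.f v))] at h4
  have h5 : ((S.card + 1 : ℕ) : ℝ) ≤ Fintype.card X.E := by
    rw [← Finset.card_insert_of_notMem hpS]
    exact_mod_cast Finset.card_le_univ _
  have h6 := mul_le_mul_of_nonneg_right h5 hc0
  push_cast at h6
  linarith

include hX hY hc0 hc in
theorem dist_spaceMap_le (x y : X.Space) :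
    dist (φ.spaceMap x) (φ.spaceMap y) ≤ dist x y + (Fintype.card X.E : ℝ) * c := by
  rcases x with u | p <;> rcases y with w | q
  · exact φ.dist_vertex_vertex_le hY hc0 hc hX u w
  · change dist (Y.vertex (φ.f u)) (Y.point (φ.interiorMap q)) ≤
      dist (X.vertex u) (X.point q) + _
    rw [dist_comm, dist_comm (X.vertex u)]
    exact φ.dist_point_vertex_le hY hc0 hc hX q u
  · exact φ.dist_point_vertex_le hY hc0 hc hX p w
  · by_cases hpq : p.1.1 = q.1.1
    · rcases le_total p.1.2 q.1.2 with h | h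
      · exact φ.dist_point_point_le_of_eq hY hc0 hc hX p q hpq h
      · change dist (Y.point (φ.interiorMap p)) (Y.point (φ.interiorMap q)) ≤
          dist (X.point p) (X.point q) + _
        rw [dist_comm, dist_comm (X.point p)]
        exact φ.dist_point_point_le_of_eq hY hc0 hc hX q p hpq.symm h
    · exact φ.dist_point_point_le_of_ne hY hc0 hc hX p q hpq

end Metric

end MDMIsom

theorem exists_isom_of_dMDM_le {X Y : MDM} {c : ℝ} (hc0 : 0 ≤ c)
    (h : dMDM X Y ≤ ENNReal.ofReal c) :
    ∃ φ : MDMIsom X Y, ∀ e, |X.len e - Y.len (φ.g e)| ≤ c := by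
  unfold dMDM at h
  rcases isEmpty_or_nonempty (MDMIsom X Y) with hE | hN
  · rw [iInf_of_empty] at h
    exact absurd h (not_le.2 ENNReal.ofReal_lt_top)
  · obtain ⟨φ, hφ⟩ := exists_eq_ciInf_of_finite
      (f := fun φ : MDMIsom X Y => ⨆ e : X.E, ENNReal.ofReal |X.len e - Y.len (φ.g e)|)
    rw [← hφ] at h
    exact ⟨φ, fun e => (ENNReal.ofReal_le_ofReal_iff hc0).1 ((le_iSup _ e).trans h)⟩


/-- Let `X` and `X'` be metric directed multigraphs, each connected
when viewed as a metric space (each edge `e` is a segment of length `len e`, endpoints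
glued according to tails and heads, orientations forgotten, and the space carrying the
shortest-path metric — here the metric space structures `mX`, `mY` are any whose distance
function is this shortest-path distance).  Then
`d_GH(X, X') ≤ (1/2) · |E| · d_𝒢(X, X')`, where `d_GH` is the Gromov–Hausdorff distance
between the associated compact metric spaces.  (Since `d_𝒢` may be `∞`, the inequality
is expressed via upper bounds: for every `c ≥ 0` with `d_𝒢(X, X') ≤ c` one has
`d_GH(X, X') ≤ (1/2) · |E| · c`; when `d_𝒢(X, X') = ∞` this holds trivially, as in the
paper.) -/
theorem ghDist_le_half_card_mul_dMDM (X Y : MDM)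
    (mX : MetricSpace X.Space) (mY : MetricSpace Y.Space)
    (hmX : ∀ x y, dist x y = X.spaceDist x y)
    (hmY : ∀ x y, dist x y = Y.spaceDist x y) :
    ∀ [ConnectedSpace X.Space] [ConnectedSpace Y.Space]
      [CompactSpace X.Space] [CompactSpace Y.Space],
    ∀ c : ℝ, 0 ≤ c → dMDM X Y ≤ ENNReal.ofReal c →
      GromovHausdorff.ghDist X.Space Y.Space ≤ 1 / 2 * (Fintype.card X.E : ℝ) * c := by
  intro _ _ _ _ c hc0 hle
  obtain ⟨φ, hc⟩ := exists_isom_of_dMDM_le hc0 hle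
  have hc' : ∀ e, |Y.len e - X.len (φ.symm.g e)| ≤ c := fun e => by
    have := hc (φ.g.symm e)
    rwa [Equiv.apply_symm_apply, abs_sub_comm] at this
  have hinv : ∀ y, φ.spaceMap (φ.symm.spaceMap y) = y := φ.symm.spaceMap_symm_spaceMap
  have hcard : Fintype.card Y.E = Fintype.card X.E := (Fintype.card_congr φ.g).symm
  have key := GromovHausdorff.ghDist_le_of_approx_subsets (s := Set.univ)
    (fun x : (Set.univ : Set X.Space) => φ.spaceMap x) (ε₁ := 0)
    (ε₂ := (Fintype.card X.E : ℝ) * c) (ε₃ := 0)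
    (fun x => ⟨x, Set.mem_univ x, (dist_self x).le⟩)
    (fun y => ⟨⟨φ.symm.spaceMap y, Set.mem_univ _⟩, by
      simp only [hinv, dist_self, le_refl]⟩)
    (fun x y => by
      have h1 := φ.dist_spaceMap_le hmY hc0 hc hmX x.1 y.1
      have h2 := φ.symm.dist_spaceMap_le hmX hc0 hc' hmY (φ.spaceMap x.1) (φ.spaceMap y.1)
      rw [φ.spaceMap_symm_spaceMap, φ.spaceMap_symm_spaceMap, hcard] at h2
      rw [Subtype.dist_eq, abs_le]
      constructor <;> linarith)
  linarith
end

section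
/- Let X be a metric directed multigraph whose strongly connected components all have different total lengths, and let (X_n, n ∈ ℕ) be metric directed multigraphs with d_𝒢(X_n, X) → 0. Then for all n large enough X_n has the same number k of strongly connected components as X and, listing the strongly connected components of X_n and of X in decreasing order of total length as (C₁ⁿ,…,C_kⁿ) and (C₁,…,C_k) respectively, d_𝒢(C_iⁿ, C_i) → 0 for every 1 ≤ i ≤ k. -/
open scoped Classical ENNReal
open Finset

namespace MDM

/-- One vertex of an MDM reaches another by a directed path. -/
def Reaches (X : MDM) : X.V → X.V → Prop :=
  Relation.ReflTransGen (fun a b => ∃ e : X.E, X.tail e = a ∧ X.head e = b)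

/-- Two vertices lie in the same strongly connected component. -/
def SameSCC (X : MDM) (u v : X.V) : Prop :=
  X.Reaches u v ∧ X.Reaches v u

/-- The strongly connected component of the vertex `v`, as an MDM: its vertices are the
vertices mutually reachable with `v`, its edges are the edges of `X` joining two such
vertices, with the induced lengths. -/
noncomputable def sccAt (X : MDM) (v : X.V) : MDM where
  V := {w : X.V // X.SameSCC v w}
  E := {e : X.E // X.SameSCC v (X.tail e) ∧ X.SameSCC v (X.head e)}
  tail e := ⟨X.tail e.1, e.2.1⟩
  head e := ⟨X.head e.1, e.2.2⟩
  len e := X.len e.1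
  len_pos e := X.len_pos e.1

/-- The total length of an MDM: the sum of the lengths of its edges. -/
noncomputable def totalLen (X : MDM) : ℝ := ∑ e : X.E, X.len e

end MDM

namespace MDMIsom

variable {X Y : MDM}

theorem reaches_map (φ : MDMIsom X Y) {u v : X.V} (h : X.Reaches u v) :
    Y.Reaches (φ.f u) (φ.f v) := by
  refine Relation.ReflTransGen.lift φ.f ?_ u v h
  rintro _ _ ⟨e, rfl, rfl⟩
  exact ⟨φ.g e, φ.tail_eq e, φ.head_eq e⟩

theorem reaches_map_iff (φ : MDMIsom X Y) {u v : X.V} :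
    Y.Reaches (φ.f u) (φ.f v) ↔ X.Reaches u v :=
  ⟨fun h => by simpa [symm] using φ.symm.reaches_map h, φ.reaches_map⟩

theorem sameSCC_map_iff (φ : MDMIsom X Y) {u v : X.V} :
    Y.SameSCC (φ.f u) (φ.f v) ↔ X.SameSCC u v :=
  and_congr φ.reaches_map_iff φ.reaches_map_iff

/-- A graph isomorphism restricts to the strongly connected component of a vertex. -/
noncomputable def sccAt (φ : MDMIsom X Y) (v : X.V) :
    MDMIsom (X.sccAt v) (Y.sccAt (φ.f v)) where
  f := φ.f.subtypeEquiv fun _ => φ.sameSCC_map_iff.symm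
  g := φ.g.subtypeEquiv fun e => by
    rw [φ.tail_eq, φ.head_eq, φ.sameSCC_map_iff, φ.sameSCC_map_iff]
  tail_eq e := Subtype.ext (φ.tail_eq e.1)
  head_eq e := Subtype.ext (φ.head_eq e.1)

theorem abs_totalLen_sub_le (φ : MDMIsom X Y) {η : ℝ}
    (h : ∀ e, |X.len e - Y.len (φ.g e)| ≤ η) :
    |X.totalLen - Y.totalLen| ≤ Fintype.card Y.E * η := by
  rw [MDM.totalLen, MDM.totalLen, ← Equiv.sum_comp φ.g, ← Finset.sum_sub_distrib,
    ← Fintype.card_congr φ.g]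
  refine (Finset.abs_sum_le_sum_abs _ _).trans ((Finset.sum_le_sum fun e _ => h e).trans ?_)
  simp

theorem dMDM_le (φ : MDMIsom X Y) {η : ℝ} (h : ∀ e, |X.len e - Y.len (φ.g e)| ≤ η) :
    dMDM X Y ≤ ENNReal.ofReal η :=
  (iInf_le _ φ).trans (iSup_le fun e => ENNReal.ofReal_le_ofReal (h e))

end MDMIsom

theorem exists_isom_of_dMDM_lt {X Y : MDM} {η : ℝ} (hη : 0 ≤ η)
    (h : dMDM X Y < ENNReal.ofReal η) :
    ∃ φ : MDMIsom X Y, ∀ e, |X.len e - Y.len (φ.g e)| ≤ η := by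
  obtain ⟨φ, hφ⟩ := iInf_lt_iff.1 h
  exact ⟨φ, fun e => (ENNReal.ofReal_le_ofReal_iff hη).1
    ((le_iSup (fun e => ENNReal.ofReal |X.len e - Y.len (φ.g e)|) e).trans hφ.le)⟩

namespace MDM

theorem card_sccAt_edges_le (X : MDM) (v : X.V) :
    Fintype.card (X.sccAt v).E ≤ Fintype.card X.E :=
  Fintype.card_le_of_injective (fun e : (X.sccAt v).E => e.1) Subtype.val_injective

/-- Strongly connected components with pairwise different total lengths can be enumerated in
strictly decreasing order of total length. -/
theorem exists_scc_reps (X : MDM)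
    (hdiff : ∀ u v : X.V, (X.sccAt u).totalLen = (X.sccAt v).totalLen → X.SameSCC u v) :
    ∃ (k : ℕ) (reps : Fin k → X.V),
      (∀ v : X.V, ∃ i, X.SameSCC (reps i) v) ∧
      (∀ i j : Fin k, i < j → (X.sccAt (reps j)).totalLen < (X.sccAt (reps i)).totalLen) := by
  set S : Finset ℝ := Finset.univ.image fun v : X.V => (X.sccAt v).totalLen with hS
  have hmem : ∀ i, ∃ v : X.V, (X.sccAt v).totalLen = S.orderEmbOfFin rfl (Fin.rev i) := by
    intro i
    have := S.orderEmbOfFin_mem rfl (Fin.rev i)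
    obtain ⟨v, -, hv⟩ := Finset.mem_image.1 this
    exact ⟨v, hv⟩
  choose reps hreps using hmem
  refine ⟨_, reps, fun v => ?_, fun i j hij => ?_⟩
  · have hv : (X.sccAt v).totalLen ∈ Set.range (S.orderEmbOfFin rfl) := by
      rw [Finset.range_orderEmbOfFin]
      simp [hS]
    obtain ⟨i, hi⟩ := hv
    exact ⟨Fin.rev i, hdiff _ _ (by rw [hreps, Fin.rev_rev, hi])⟩
  · rw [hreps, hreps]
    exact (S.orderEmbOfFin rfl).strictMono (Fin.rev_lt_rev.2 hij)

theorem SameSCC.totalLen_sccAt_eq {X : MDM} {u v : X.V} (h : X.SameSCC u v) :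
    (X.sccAt u).totalLen = (X.sccAt v).totalLen := by
  have hiff : ∀ w, X.SameSCC u w ↔ X.SameSCC v w := fun w =>
    ⟨fun hw => ⟨h.2.trans hw.1, hw.2.trans h.1⟩, fun hw => ⟨h.1.trans hw.1, hw.2.trans h.2⟩⟩
  exact Fintype.sum_equiv (Equiv.subtypeEquivRight fun e => and_congr (hiff _) (hiff _)) _ _
    fun _ => rfl

end MDM

open Filter in
/-- Let `X` be an MDM whose strongly connected components all have
different total lengths, and let `(Xₙ)` be MDMs with `d_𝒢(Xₙ, X) → 0`.  Then there is a
`k` such that `X` has exactly `k` strongly connected components — enumerated by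
representatives `reps 0, …, reps (k-1)` in strictly decreasing order of total length —
and such that, for every `ε > 0`, eventually in `n` the MDM `Xₙ` also has exactly `k`
strongly connected components which, listed in decreasing order of total length as
`C₁ⁿ, …, C_kⁿ`, satisfy `d_𝒢(Cᵢⁿ, Cᵢ) < ε` for every `i`. -/
theorem scc_converge_of_dMDM_tendsto_zero
    (X : MDM)
    (hdiff : ∀ u v : X.V, (X.sccAt u).totalLen = (X.sccAt v).totalLen → X.SameSCC u v)
    (Xn : ℕ → MDM)
    (hconv : Tendsto (fun n => dMDM (Xn n) X) atTop (nhds 0)) :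
    ∃ (k : ℕ) (reps : Fin k → X.V),
      (∀ i j, i ≠ j → ¬ X.SameSCC (reps i) (reps j)) ∧
      (∀ v : X.V, ∃ i, X.SameSCC (reps i) v) ∧
      (∀ i j : Fin k, i < j → (X.sccAt (reps j)).totalLen < (X.sccAt (reps i)).totalLen) ∧
      ∀ ε : ℝ≥0∞, 0 < ε → ∀ᶠ n in atTop, ∃ repsn : Fin k → (Xn n).V,
        (∀ i j, i ≠ j → ¬ (Xn n).SameSCC (repsn i) (repsn j)) ∧
        (∀ v : (Xn n).V, ∃ i, (Xn n).SameSCC (repsn i) v) ∧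
        (∀ i j : Fin k, i < j →
          ((Xn n).sccAt (repsn j)).totalLen ≤ ((Xn n).sccAt (repsn i)).totalLen) ∧
        (∀ i, dMDM ((Xn n).sccAt (repsn i)) (X.sccAt (reps i)) < ε) := by
  obtain ⟨k, reps, hcover, hlt⟩ := X.exists_scc_reps hdiff
  have hne : ∀ i j, i ≠ j → ¬ X.SameSCC (reps i) (reps j) := fun i j hij h =>
    hij.lt_or_gt.elim (fun hl => (hlt _ _ hl).ne' h.totalLen_sccAt_eq)
      fun hl => (hlt _ _ hl).ne h.totalLen_sccAt_eq
  refine ⟨k, reps, hne, hcover, hlt, fun ε hε => ?_⟩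
  obtain ⟨η, hη, hηε, hgap⟩ : ∃ η : ℝ, 0 < η ∧ ENNReal.ofReal η < ε ∧ ∀ i j : Fin k, i < j →
      2 * (Fintype.card X.E * η) < (X.sccAt (reps i)).totalLen - (X.sccAt (reps j)).totalLen := by
    have hsmall : ∀ᶠ η : ℝ in nhds 0, ENNReal.ofReal η < ε :=
      ENNReal.continuous_ofReal.continuousAt.eventually_lt continuousAt_const (by simpa using hε)
    have hgap : ∀ᶠ η : ℝ in nhds 0, ∀ i j : Fin k, i < j → 2 * (Fintype.card X.E * η) <
        (X.sccAt (reps i)).totalLen - (X.sccAt (reps j)).totalLen := by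
      simp only [eventually_all]
      intro i j hij
      refine ContinuousAt.eventually_lt (by fun_prop) continuousAt_const ?_
      simpa using hlt i j hij
    obtain ⟨η, ⟨h₁, h₂⟩, hη⟩ := (((hsmall.and hgap).filter_mono nhdsWithin_le_nhds).and
      (self_mem_nhdsWithin (s := Set.Ioi (0 : ℝ)))).exists
    exact ⟨η, hη, h₁, h₂⟩
  filter_upwards [hconv.eventually_lt_const (ENNReal.ofReal_pos.2 hη)] with n hn
  obtain ⟨φ, hφ⟩ := exists_isom_of_dMDM_lt hη.le hn
  choose repsn hrepsn using fun i => φ.f.surjective (reps i)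
  have hlen : ∀ i, |((Xn n).sccAt (repsn i)).totalLen - (X.sccAt (reps i)).totalLen| ≤
      Fintype.card X.E * η := fun i => by
    rw [← hrepsn i]
    refine ((φ.sccAt (repsn i)).abs_totalLen_sub_le fun e => hφ e.1).trans ?_
    gcongr
    exact X.card_sccAt_edges_le _
  refine ⟨repsn, fun i j hij h => hne i j hij ?_, fun v => ?_, fun i j hij => ?_, fun i => ?_⟩
  · rwa [← hrepsn, ← hrepsn, φ.sameSCC_map_iff]
  · obtain ⟨i, hi⟩ := hcover (φ.f v)
    exact ⟨i, by rwa [← φ.sameSCC_map_iff, hrepsn]⟩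
  · linarith [abs_le.1 (hlen i), abs_le.1 (hlen j), hgap i j hij]
  · rw [← hrepsn i]
    exact ((φ.sccAt (repsn i)).dMDM_le fun e => hφ e.1).trans_lt hηε
end

section
/- Let 𝖳_n be a uniformly random labelled tree on [n], rooted at vertex 1, with vertices v₁,…,v_n listed in the planar (depth-first) order of its canonical planar embedding. For a vertex v, let Y_v(n) be the number of vertices of the subtree of 𝖳_n rooted at v which lie outside the largest of the subtrees rooted at the children of v (ties broken by planar order). Then lim_{M→∞} limsup_{n→∞} sup_{1≤i≤n} P[Y_{v_i}(n) > M] = 0. -/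
open Finset
open scoped Classical

namespace RandomTree

/-- The state of the depth-first exploration: the ordered stack of open vertices and the
list of explored vertices, in order of exploration. -/
structure St (m : ℕ) where
  stack : List (Fin m)
  visited : List (Fin m)

/-- One step of the depth-first exploration of the graph with adjacency `adj`. -/
def step {m : ℕ} (adj : Fin m → Fin m → Bool) (s : St m) : St m :=
  match s.stack with
  | [] => s
  | v :: rest =>
    let visited' := s.visited ++ [v]
    let ns := (List.finRange m).filter
      (fun w => adj v w && !(decide (w ∈ s.stack)) && !(decide (w ∈ s.visited)))
    let stack' := ns ++ rest
    let stack'' := if stack'.isEmpty then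
        ((List.finRange m).filter (fun w => !(decide (w ∈ visited')))).take 1
      else stack'
    ⟨stack'', visited', ⟩

/-- The state of the depth-first exploration started at the root `r` after `i` steps. -/
def stateAt {m : ℕ} (adj : Fin m → Fin m → Bool) (r : Fin m) (i : ℕ) : St m :=
  (step adj)^[i] ⟨[r], []⟩

/-- `par` is the parent map of a tree on `Fin m` rooted at `r`: iterating the parent map
from any vertex leads to the root. -/
def IsPTree {m : ℕ} (par : Fin m → Fin m) (r : Fin m) : Prop :=
  par r = r ∧ ∀ v, ∃ k : ℕ, par^[k] v = r

/-- The set of (parent maps of) labelled trees on `Fin m` rooted at `r`. -/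
noncomputable def treeFinset (m : ℕ) (r : Fin m) : Finset (Fin m → Fin m) :=
  univ.filter (fun par => IsPTree par r)

/-- The adjacency function of the canonical plane embedding of the tree with parent map
`par`: edges from each vertex to its children (children are listed in increasing order of
label by the exploration itself). -/
def childAdj {m : ℕ} (par : Fin m → Fin m) (r : Fin m) : Fin m → Fin m → Bool :=
  fun v w => decide (w ≠ r) && decide (par w = v)

/-- The depth-first (planar) order of the vertices of the tree, as a list
`[v₁, …, v_m]`. -/
def dfsOrder {m : ℕ} (par : Fin m → Fin m) (r : Fin m) : List (Fin m) :=
  (stateAt (childAdj par r) r m).visited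

/-- The position of a vertex in the depth-first (planar) order. -/
def dfsPos {m : ℕ} (par : Fin m → Fin m) (r : Fin m) (v : Fin m) : ℕ :=
  (dfsOrder par r).findIdx (fun w => decide (w = v))

/-- The number of vertices of the subtree rooted at `v` (including `v`). -/
noncomputable def subSize {m : ℕ} (par : Fin m → Fin m) (v : Fin m) : ℕ :=
  Set.ncard {w : Fin m | ∃ k : ℕ, par^[k] w = v}

/-- The number of vertices of the subtree rooted at `v` lying outside the largest of the
subtrees rooted at a child of `v`. -/
noncomputable def outsideLargest {m : ℕ} (par : Fin m → Fin m) (r : Fin m) (v : Fin m) : ℕ :=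
  subSize par v - (univ.filter (fun c : Fin m => c ≠ r ∧ par c = v)).sup (subSize par)

section Forests
variable {V : Type*} [Fintype V] [DecidableEq V]

/-- The parent maps of rooted forests with vertex set `S` and root set `R`; vertices outside
`S \ R` are fixed. -/
noncomputable def forests (S R : Finset V) : Finset (V → V) :=
  univ.filter fun f => (∀ v, v ∉ S \ R → f v = v) ∧ (∀ v ∈ S, f v ∈ S) ∧
    ∀ v ∈ S, ∃ k : ℕ, f^[k] v ∈ R

theorem mem_forests {S R : Finset V} {f : V → V} :
    f ∈ forests S R ↔ (∀ v, v ∉ S \ R → f v = v) ∧ (∀ v ∈ S, f v ∈ S) ∧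
      ∀ v ∈ S, ∃ k : ℕ, f^[k] v ∈ R := by
  simp [forests]

theorem forests_self (S : Finset V) : forests S S = {id} := by
  ext f
  simp only [mem_forests, mem_singleton, Finset.sdiff_self, notMem_empty, not_false_eq_true, true_imp_iff]
  constructor
  · exact fun h => funext h.1
  · rintro rfl
    exact ⟨fun _ => rfl, fun _ h => h, fun v h => ⟨0, h⟩⟩

theorem forests_empty {S : Finset V} (hS : S.Nonempty) : forests S ∅ = ∅ := by
  obtain ⟨v, hv⟩ := hS
  refine eq_empty_of_forall_notMem fun f hf => ?_
  obtain ⟨k, hk⟩ := (mem_forests.1 hf).2.2 v hv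
  simp at hk

/-- Removing the roots of a forest leaves a forest rooted at the vertices of the first
generation `U`, together with the map from `U` to the roots. -/
theorem card_forests_filter {S R U : Finset V} (hR : R ⊆ S) (hU : U ⊆ S \ R) :
    ((forests S R).filter fun f => (S \ R).filter (fun v => f v ∈ R) = U).card =
      R.card ^ U.card * (forests (S \ R) U).card := by
  have hpi : (Fintype.piFinset fun v => if v ∈ U then R else {v}).card = R.card ^ U.card := by
    rw [Fintype.card_piFinset]
    simp only [apply_ite Finset.card, card_singleton]
    rw [prod_ite]
    simp
  rw [← hpi, ← card_product]
  refine card_bij' (fun f _ => (fun v => if v ∈ U then f v else v, fun v => if v ∈ U then v else f v))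
    (fun p _ v => if v ∈ U then p.1 v else p.2 v) ?_ ?_ ?_ ?_
  · rintro f hf
    obtain ⟨hf, hfU⟩ := mem_filter.1 hf
    obtain ⟨h1, h2, h3⟩ := mem_forests.1 hf
    have hUiff : ∀ v ∈ S \ R, (v ∈ U ↔ f v ∈ R) := fun v hv => by
      rw [← hfU]; simp only [mem_filter, hv, true_and]
    refine mem_product.2 ⟨?_, mem_forests.2 ⟨?_, ?_, ?_⟩⟩
    · rw [Fintype.mem_piFinset]
      intro v
      by_cases hv : v ∈ U
      · simpa [hv] using (hUiff v (hU hv)).1 hv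
      · simp [hv]
    · intro v hv
      by_cases hvU : v ∈ U
      · simp [hvU]
      · simp only [hvU, if_false]
        exact h1 v fun h => hv (mem_sdiff.2 ⟨h, hvU⟩)
    · intro v hv
      by_cases hvU : v ∈ U
      · simpa [hvU] using hv
      · simp only [hvU, if_false]
        exact mem_sdiff.2 ⟨h2 v (mem_sdiff.1 hv).1, fun h => hvU ((hUiff v hv).2 h)⟩
    · intro v hv
      obtain ⟨k, hk⟩ := h3 v (mem_sdiff.1 hv).1
      induction k generalizing v with
      | zero => exact absurd hk (mem_sdiff.1 hv).2
      | succ k ih =>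
        by_cases hvU : v ∈ U
        · exact ⟨0, hvU⟩
        · have hfv : f v ∈ S \ R :=
            mem_sdiff.2 ⟨h2 v (mem_sdiff.1 hv).1, fun h => hvU ((hUiff v hv).2 h)⟩
          obtain ⟨l, hl⟩ := ih (f v) hfv hk
          refine ⟨l + 1, ?_⟩
          simpa [hvU] using hl
  · rintro ⟨p, g⟩ hpg
    obtain ⟨hp, hg⟩ := mem_product.1 hpg
    rw [Fintype.mem_piFinset] at hp
    obtain ⟨h1, h2, h3⟩ := mem_forests.1 hg
    have hpR : ∀ v ∈ U, p v ∈ R := fun v hv => by simpa [hv] using hp v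
    refine mem_filter.2 ⟨mem_forests.2 ⟨?_, ?_, ?_⟩, ?_⟩
    · intro v hv
      have hvU : v ∉ U := fun h => hv (hU h)
      simp only [hvU, if_false]
      exact h1 v fun h => hv (mem_sdiff.1 h).1
    · intro v hv
      by_cases hvU : v ∈ U
      · simpa [hvU] using hR (hpR v hvU)
      · simp only [hvU, if_false]
        by_cases hvR : v ∈ R
        · have hgv : g v = v := h1 v (by simp [hvR])
          simpa [hgv] using hv
        · exact (mem_sdiff.1 (h2 v (mem_sdiff.2 ⟨hv, hvR⟩))).1
    · intro v hv
      by_cases hvR : v ∈ R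
      · exact ⟨0, hvR⟩
      have hvA : v ∈ S \ R := mem_sdiff.2 ⟨hv, hvR⟩
      clear hv hvR
      obtain ⟨k, hk⟩ := h3 v hvA
      induction k generalizing v with
      | zero => exact ⟨1, by simpa [show v ∈ U from hk] using hpR v hk⟩
      | succ k ih =>
        by_cases hvU : v ∈ U
        · exact ⟨1, by simpa [hvU] using hpR v hvU⟩
        · obtain ⟨l, hl⟩ := ih (g v) (h2 v hvA) hk
          exact ⟨l + 1, by simpa [hvU] using hl⟩
    · ext v
      by_cases hvU : v ∈ U
      · simp only [mem_filter, hU hvU, hvU, if_true, hpR v hvU, and_self]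
      · simp only [mem_filter, hvU, if_false, iff_false, not_and]
        exact fun hv => (mem_sdiff.1 (h2 v hv)).2
  · intro f _
    ext v
    by_cases hv : v ∈ U <;> simp [hv]
  · rintro ⟨p, g⟩ hpg
    obtain ⟨hp, hg⟩ := mem_product.1 hpg
    rw [Fintype.mem_piFinset] at hp
    ext v
    · by_cases hv : v ∈ U
      · simp [hv]
      · have := hp v
        simp only [hv, if_false, mem_singleton] at this
        simp [hv, this]
    · by_cases hv : v ∈ U
      · simpa [hv] using ((mem_forests.1 hg).1 v (by simp [hv])).symm
      · simp [hv]

theorem sum_choose_mul_pow_mul (a k : ℕ) :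
    ∑ s ∈ range (a + 2), (a + 1).choose s * (k ^ s * (s * (a + 1) ^ (a + 1 - s))) =
      (a + 1) * (k * (k + (a + 1)) ^ a) := by
  rw [sum_range_succ', add_pow k (a + 1) a, mul_sum, mul_sum, zero_mul, mul_zero, mul_zero, add_zero]
  refine sum_congr rfl fun s hs => ?_
  have h := Nat.add_one_mul_choose_eq a s
  rw [show a + 1 - (s + 1) = a - s by omega]
  calc _ = ((a + 1).choose (s + 1) * (s + 1)) * (k ^ (s + 1) * (a + 1) ^ (a - s)) := by ring
    _ = _ := by rw [← h, Nat.cast_id]; ring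

/-- **Cayley's formula** for rooted forests. -/
theorem card_mul_card_forests (S R : Finset V) (hR : R ⊆ S) :
    S.card * (forests S R).card = R.card * S.card ^ (S.card - R.card) := by
  induction S using Finset.strongInduction generalizing R with
  | H S ih =>
    rcases hR.eq_or_ssubset with rfl | hRS
    · simp [forests_self]
    rcases R.eq_empty_or_nonempty with rfl | hRne
    · rw [forests_empty (by simpa [empty_ssubset] using hRS)]; simp
    have hA : S \ R ⊂ S := sdiff_ssubset hR hRne
    have hcard : (S \ R).card + R.card = S.card := card_sdiff_add_card_eq_card hR
    have hApos : 0 < (S \ R).card := by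
      have := card_lt_card hRS; omega
    obtain ⟨a, ha⟩ : ∃ a, (S \ R).card = a + 1 := ⟨(S \ R).card - 1, by omega⟩
    have key : (a + 1) * (forests S R).card = (a + 1) * (R.card * (R.card + (a + 1)) ^ a) := by
      rw [← sum_choose_mul_pow_mul,
        card_eq_sum_card_fiberwise (f := fun f => (S \ R).filter (fun v => f v ∈ R))
          (t := (S \ R).powerset) (fun f _ => by
            exact mem_coe.2 (mem_powerset.2 (filter_subset _ _))), mul_sum,
        show a + 2 = (S \ R).card + 1 by omega, ← ha]
      simp only [← smul_eq_mul (a := Nat.choose _ _)]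
      rw [← sum_powerset_apply_card (fun s => R.card ^ s * (s * (S \ R).card ^ ((S \ R).card - s)))]
      refine sum_congr rfl fun U hU => ?_
      rw [mem_powerset] at hU
      rw [card_forests_filter hR hU, ← ih _ hA U hU]
      ring
    rw [Nat.eq_of_mul_eq_mul_left (Nat.succ_pos a) key, ← hcard, ha]
    rw [show a + 1 + R.card - R.card = a + 1 by omega]
    ring

end Forests
theorem factorial_le_stirling {n : ℕ} (hn : 1 ≤ n) :
    (n.factorial : ℝ) ≤ Real.exp 1 * (√n * (n / Real.exp 1) ^ n) := by
  obtain ⟨k, rfl⟩ : ∃ k, n = k + 1 := ⟨n - 1, by omega⟩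
  have h := Stirling.stirlingSeq'_antitone (Nat.zero_le k)
  simp only [Function.comp_apply] at h
  rw [Stirling.stirlingSeq_one, Stirling.stirlingSeq] at h
  rw [div_le_iff₀ (by positivity)] at h
  refine h.trans_eq ?_
  rw [Real.sqrt_mul (by norm_num)]
  field_simp

theorem stirling_le_factorial (n : ℕ) :
    √n * (n / Real.exp 1) ^ n ≤ (n.factorial : ℝ) := by
  refine le_trans ?_ (Stirling.le_factorial_stirling n)
  gcongr
  nlinarith [Real.pi_gt_three, (Nat.cast_nonneg n : (0 : ℝ) ≤ n)]

theorem choose_mul_pow_le {m j : ℕ} (hm : 1 ≤ m) (hj : 1 ≤ j) :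
    ((m + j).choose m : ℝ) * (m : ℝ) ^ m * (j : ℝ) ^ j * (√m * √j) ≤
      Real.exp 1 * √((m + j : ℕ) : ℝ) * ((m + j : ℕ) : ℝ) ^ (m + j) := by
  have h1 := stirling_le_factorial m
  have h2 := stirling_le_factorial j
  have h3 := factorial_le_stirling (n := m + j) (by omega)
  have h4 : ((m + j).choose m : ℝ) * m.factorial * j.factorial = (m + j).factorial := by
    have := Nat.choose_mul_factorial_mul_factorial (Nat.le_add_right m j)
    rw [Nat.add_sub_cancel_left] at this
    exact_mod_cast this
  have h5 : ((m + j).choose m : ℝ) * (√m * (m / Real.exp 1) ^ m) * (√j * (j / Real.exp 1) ^ j) ≤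
      Real.exp 1 * (√((m + j : ℕ) : ℝ) * (((m + j : ℕ) : ℝ) / Real.exp 1) ^ (m + j)) := by
    refine le_trans ?_ (h4.trans_le h3)
    gcongr
  simp only [div_pow] at h5
  have he : 0 < Real.exp 1 ^ (m + j) := by positivity
  have := mul_le_mul_of_nonneg_right h5 he.le
  refine le_trans (le_of_eq ?_) (this.trans_eq ?_)
  · rw [pow_add]; field_simp
  · field_simp

/-- The left side is the number of rooted trees on `m + j` vertices in which the branch of a given
vertex has size `m`; on the right, the last factor is the number of all trees. -/
theorem branch_weight_le {m j : ℕ} (hm : 1 ≤ m) (hj : 1 ≤ j) :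
    ((m + j - 2).choose (m - 1) : ℝ) * (m : ℝ) ^ (m - 1) * ((j : ℝ) ^ (j - 1) / j) ≤
      2 * Real.exp 1 * (√((m + j : ℕ) : ℝ) / (√m * √j * j)) *
        (((m + j : ℕ) : ℝ) ^ (m + j - 1) / ((m + j : ℕ) : ℝ)) := by
  obtain ⟨a, rfl⟩ : ∃ a, m = a + 1 := ⟨m - 1, by omega⟩
  obtain ⟨b, rfl⟩ : ∃ b, j = b + 1 := ⟨j - 1, by omega⟩
  have h := choose_mul_pow_le hm hj
  have hc : ((a + 1 + (b + 1)).choose (a + 1) : ℝ) * (a + 1) * (b + 1) =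
      (a + b).choose a * (a + b + 2) * (a + b + 1) := by
    have e1 := Nat.add_one_mul_choose_eq (a + b + 1) a
    have e2 := Nat.add_one_mul_choose_eq (a + b) b
    have e3 : (a + b + 1).choose a = (a + b + 1).choose (b + 1) := by
      rw [← Nat.choose_symm_of_eq_add]; omega
    have e4 : (a + b).choose b = (a + b).choose a := by
      rw [← Nat.choose_symm_of_eq_add]; omega
    rw [e3] at e1
    rw [e4] at e2
    rw [show a + 1 + (b + 1) = a + b + 1 + 1 by ring]
    have e1' : ((a : ℝ) + b + 1 + 1) * ((a + b + 1).choose (b + 1) : ℝ) =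
      ((a + b + 1 + 1).choose (a + 1) : ℝ) * (a + 1) := by exact_mod_cast e1
    have e2' : ((a : ℝ) + b + 1) * ((a + b).choose a : ℝ) =
      ((a + b + 1).choose (b + 1) : ℝ) * (b + 1) := by exact_mod_cast e2
    rw [← e1', mul_assoc, ← e2']
    ring
  rw [show a + 1 + (b + 1) - 2 = a + b by omega, show a + 1 + (b + 1) - 1 = a + b + 1 by omega,
    show a + 1 - 1 = a by omega, show b + 1 - 1 = b by omega]
  rw [show a + 1 + (b + 1) = a + b + 1 + 1 by omega] at h hc ⊢
  push_cast at h hc ⊢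
  have hA : (0 : ℝ) < a + 1 := by positivity
  have hB : (0 : ℝ) < b + 1 := by positivity
  have hK : (0 : ℝ) < a + b + 1 + 1 := by positivity
  have hsA : 0 < √((a : ℝ) + 1) := Real.sqrt_pos.2 hA
  have hsB : 0 < √((b : ℝ) + 1) := Real.sqrt_pos.2 hB
  have hsK : 0 < √((a : ℝ) + b + 1 + 1) := Real.sqrt_pos.2 hK
  set C := ((a + b).choose a : ℝ)
  set D := ((a + b + 1 + 1).choose (a + 1) : ℝ)
  have hD : D = C * (a + b + 2) * (a + b + 1) / ((a + 1) * (b + 1)) := by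
    rw [← hc]; field_simp
  rw [hD] at h
  have h6 : C * (a + b + 1 + 1) * (a + b + 1) * ((a : ℝ) + 1) ^ a * ((b : ℝ) + 1) ^ b *
      (√((a : ℝ) + 1) * √((b : ℝ) + 1)) ≤
      Real.exp 1 * √((a : ℝ) + b + 1 + 1) * ((a : ℝ) + b + 1 + 1) ^ (a + b + 1 + 1) := by
    refine le_trans (le_of_eq ?_) h
    rw [pow_succ _ a, pow_succ _ b]; field_simp; ring
  have h7 : C * ((a : ℝ) + 1) ^ a * ((b : ℝ) + 1) ^ b * (√((a : ℝ) + 1) * √((b : ℝ) + 1)) *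
      ((a : ℝ) + b + 1 + 1) ≤ 2 *
      (Real.exp 1 * √((a : ℝ) + b + 1 + 1) * ((a : ℝ) + b + 1 + 1) ^ (a + b + 1)) := by
    have h8 : (a : ℝ) + b + 1 + 1 ≤ 2 * (a + b + 1) := by
      have : (0 : ℝ) ≤ a + b := by positivity
      linarith
    rw [pow_succ _ (a + b + 1), ← mul_assoc (Real.exp 1 * _)] at h6
    have h9 : C * (a + b + 1) * ((a : ℝ) + 1) ^ a * ((b : ℝ) + 1) ^ b *
      (√((a : ℝ) + 1) * √((b : ℝ) + 1)) ≤
      Real.exp 1 * √((a : ℝ) + b + 1 + 1) * ((a : ℝ) + b + 1 + 1) ^ (a + b + 1) := by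
      refine le_of_mul_le_mul_right ?_ hK
      refine le_trans (le_of_eq ?_) h6
      ring
    calc _ ≤ C * ((a : ℝ) + 1) ^ a * ((b : ℝ) + 1) ^ b * (√((a : ℝ) + 1) * √((b : ℝ) + 1)) *
      (2 * (a + b + 1)) := by gcongr
      _ = 2 * (C * (a + b + 1) * ((a : ℝ) + 1) ^ a * ((b : ℝ) + 1) ^ b *
      (√((a : ℝ) + 1) * √((b : ℝ) + 1))) := by ring
      _ ≤ _ := by gcongr
  have h10 : C * ((a : ℝ) + 1) ^ a * (((b : ℝ) + 1) ^ b / (b + 1)) =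
      (C * ((a : ℝ) + 1) ^ a * ((b : ℝ) + 1) ^ b * (√((a : ℝ) + 1) * √((b : ℝ) + 1)) *
      ((a : ℝ) + b + 1 + 1)) / ((√((a : ℝ) + 1) * √((b : ℝ) + 1) * (b + 1)) * ((a : ℝ) + b + 1 + 1)) := by
    field_simp
  rw [h10, div_le_iff₀ (by positivity)]
  refine h7.trans_eq ?_
  field_simp

theorem sqrt_ratio_le {m j M : ℕ} (hm : 1 ≤ m) (hM : 1 ≤ M) (hj : M ≤ j) :
    √((m + j : ℕ) : ℝ) / (√m * √j * j) ≤
      (M : ℝ) ^ (-(1 / 4) : ℝ) * (2 * (j : ℝ) ^ (-(5 / 4) : ℝ) + (m : ℝ) ^ (-(5 / 4) : ℝ)) := by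
  have hm0 : (0 : ℝ) < m := by exact_mod_cast hm
  have hM0 : (0 : ℝ) < M := by exact_mod_cast hM
  have hjM : (M : ℝ) ≤ j := by exact_mod_cast hj
  have hj0 : (0 : ℝ) < j := hM0.trans_le hjM
  have hq : (j : ℝ) ^ (-(1 / 4) : ℝ) ≤ (M : ℝ) ^ (-(1 / 4) : ℝ) :=
    Real.rpow_le_rpow_of_nonpos hM0 hjM (by norm_num)
  have h1 : √((m + j : ℕ) : ℝ) ≤ √m + √j := by
    push_cast
    rw [Real.sqrt_le_left (by positivity), add_sq, Real.sq_sqrt hm0.le, Real.sq_sqrt hj0.le]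
    linarith [mul_nonneg (Real.sqrt_nonneg (m : ℝ)) (Real.sqrt_nonneg (j : ℝ))]
  have e1 : √(m : ℝ) / (√m * √j * j) = (j : ℝ) ^ (-(1 / 4) : ℝ) * (j : ℝ) ^ (-(5 / 4) : ℝ) := by
    rw [← Real.rpow_add hj0, mul_assoc, div_mul_cancel_left₀ (Real.sqrt_pos.2 hm0).ne',
      Real.sqrt_eq_rpow, ← Real.rpow_add_one hj0.ne', ← Real.rpow_neg hj0.le]
    norm_num
  have e2 : √(j : ℝ) / (√m * √j * j) =
      (j : ℝ) ^ (-(1 / 4) : ℝ) * ((j : ℝ) ^ (-(3 / 4) : ℝ) * (m : ℝ) ^ (-(1 / 2) : ℝ)) := by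
    rw [← mul_assoc, ← Real.rpow_add hj0, mul_right_comm, mul_comm,
      Real.rpow_neg hm0.le, ← Real.sqrt_eq_rpow]
    norm_num [Real.rpow_neg_one]
    field_simp
  have h2 : (j : ℝ) ^ (-(3 / 4) : ℝ) * (m : ℝ) ^ (-(1 / 2) : ℝ) ≤
      (j : ℝ) ^ (-(5 / 4) : ℝ) + (m : ℝ) ^ (-(5 / 4) : ℝ) := by
    rcases le_total (j : ℝ) m with h | h
    · have : (m : ℝ) ^ (-(1 / 2) : ℝ) ≤ (j : ℝ) ^ (-(1 / 2) : ℝ) :=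
        Real.rpow_le_rpow_of_nonpos hj0 h (by norm_num)
      calc _ ≤ (j : ℝ) ^ (-(3 / 4) : ℝ) * (j : ℝ) ^ (-(1 / 2) : ℝ) := by gcongr
        _ = (j : ℝ) ^ (-(5 / 4) : ℝ) := by rw [← Real.rpow_add hj0]; norm_num
        _ ≤ _ := le_add_of_nonneg_right (by positivity)
    · have : (j : ℝ) ^ (-(3 / 4) : ℝ) ≤ (m : ℝ) ^ (-(3 / 4) : ℝ) :=
        Real.rpow_le_rpow_of_nonpos hm0 h (by norm_num)
      calc _ ≤ (m : ℝ) ^ (-(3 / 4) : ℝ) * (m : ℝ) ^ (-(1 / 2) : ℝ) := by gcongr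
        _ = (m : ℝ) ^ (-(5 / 4) : ℝ) := by rw [← Real.rpow_add hm0]; norm_num
        _ ≤ _ := le_add_of_nonneg_left (by positivity)
  calc _ ≤ (√m + √j) / (√m * √j * j) := by gcongr
    _ = (j : ℝ) ^ (-(1 / 4) : ℝ) * ((j : ℝ) ^ (-(5 / 4) : ℝ) +
        (j : ℝ) ^ (-(3 / 4) : ℝ) * (m : ℝ) ^ (-(1 / 2) : ℝ)) := by rw [add_div, e1, e2]; ring
    _ ≤ (M : ℝ) ^ (-(1 / 4) : ℝ) * ((j : ℝ) ^ (-(5 / 4) : ℝ) +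
        ((j : ℝ) ^ (-(5 / 4) : ℝ) + (m : ℝ) ^ (-(5 / 4) : ℝ))) := by gcongr
    _ = _ := by ring

section Branches
variable {V : Type*} [Fintype V]

/-- The set of vertices from which `v` is reached by iterating `f`. -/
noncomputable def desc (f : V → V) (v : V) : Finset V :=
  univ.filter fun w => ∃ k : ℕ, f^[k] w = v

theorem mem_desc {f : V → V} {v w : V} : w ∈ desc f v ↔ ∃ k : ℕ, f^[k] w = v := by
  simp [desc]

theorem self_mem_desc (f : V → V) (v : V) : v ∈ desc f v := mem_desc.2 ⟨0, rfl⟩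

theorem mem_desc_of_apply {f : V → V} {v w : V} (h : f w ∈ desc f v) : w ∈ desc f v := by
  obtain ⟨k, hk⟩ := mem_desc.1 h
  exact mem_desc.2 ⟨k + 1, hk⟩

theorem apply_mem_desc {f : V → V} {v w : V} (h : w ∈ desc f v) (hw : w ≠ v) :
    f w ∈ desc f v := by
  obtain ⟨k, hk⟩ := mem_desc.1 h
  cases k with
  | zero => exact absurd hk hw
  | succ k => exact mem_desc.2 ⟨k, hk⟩

/-- Induction along the path from `w` to `v`. -/
theorem desc_induction {f : V → V} {v : V} {P : V → Prop} (hv : P v)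
    (hstep : ∀ w, w ∈ desc f v → w ≠ v → P (f w) → P w) {w : V} (hw : w ∈ desc f v) : P w := by
  obtain ⟨k, hk⟩ := mem_desc.1 hw
  induction k generalizing w with
  | zero => exact (show w = v from hk) ▸ hv
  | succ k ih =>
    by_cases h : w = v
    · exact h ▸ hv
    · exact hstep w hw h (ih (apply_mem_desc hw h) hk)

variable [DecidableEq V]

theorem mem_forests_singleton {S : Finset V} {v : V} {f : V → V} :
    f ∈ forests S {v} ↔ (∀ w, (w ∈ S → w = v) → f w = w) ∧ (∀ w ∈ S, f w ∈ S) ∧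
      ∀ w ∈ S, w ∈ desc f v := by
  simp [mem_forests, mem_desc]

theorem card_tree (S : Finset V) {v : V} (hv : v ∈ S) :
    ((forests S {v}).card : ℝ) = (S.card : ℝ) ^ (S.card - 1) / S.card := by
  have h := card_mul_card_forests S {v} (singleton_subset_iff.2 hv)
  have hS : (S.card : ℝ) ≠ 0 := by
    have : S.Nonempty := ⟨v, hv⟩
    exact_mod_cast this.card_pos.ne'
  rw [card_singleton, one_mul] at h
  rw [eq_div_iff hS, mul_comm]
  exact_mod_cast h

/-- The parent map obtained by hanging the tree `p.1` on `B` with root `c` below the vertex `v`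
of `p.2`. -/
def hang (v c : V) (B : Finset V) (p : (V → V) × (V → V)) : V → V :=
  fun w => if w ∈ B then (if w = c then v else p.1 w) else p.2 w

theorem exists_hang_eq {S : Finset V} {v c : V} {g : V → V} (hg : g ∈ forests S {v})
    (hcS : c ∈ S) (hcv : c ≠ v) (hgc : g c = v) :
    desc g c ⊆ S.erase v ∧ ∃ p ∈ forests (desc g c) {c} ×ˢ forests (S \ desc g c) {v},
      hang v c (desc g c) p = g := by
  obtain ⟨h1, h2, h3⟩ := mem_forests_singleton.1 hg
  have hvB : v ∉ desc g c := fun h => by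
    obtain ⟨k, hk⟩ := mem_desc.1 h
    rw [Function.iterate_fixed (h1 v fun _ => rfl)] at hk
    exact hcv hk.symm
  refine ⟨fun w hw => ?_, (fun w => if w ∈ desc g c ∧ w ≠ c then g w else w,
    fun w => if w ∈ desc g c then w else g w), mem_product.2
      ⟨mem_forests_singleton.2 ⟨?_, ?_, ?_⟩, mem_forests_singleton.2 ⟨?_, ?_, ?_⟩⟩, ?_⟩
  · refine mem_erase.2 ⟨fun h => hvB (h ▸ hw), ?_⟩
    by_contra hwS
    obtain ⟨k, hk⟩ := mem_desc.1 hw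
    rw [Function.iterate_fixed (h1 w fun h => absurd h hwS)] at hk
    exact hwS (hk ▸ hcS)
  · intro w hw
    exact if_neg fun h => h.2 (hw h.1)
  · intro w hw
    by_cases hwc : w = c
    · simpa [hwc] using self_mem_desc g c
    · simpa [hw, hwc] using apply_mem_desc hw hwc
  · intro w hw
    refine desc_induction (f := g) (self_mem_desc _ _) (fun w hw hwc ih => ?_) hw
    apply mem_desc_of_apply
    simpa [hw, hwc] using ih
  · intro w hw
    by_cases hwB : w ∈ desc g c
    · simp [hwB]
    · simp only [hwB, if_false]
      exact h1 w fun h => hw (mem_sdiff.2 ⟨h, hwB⟩)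
  · intro w hw
    obtain ⟨hwS, hwB⟩ := mem_sdiff.1 hw
    simp only [hwB, if_false]
    exact mem_sdiff.2 ⟨h2 w hwS, fun h => hwB (mem_desc_of_apply h)⟩
  · intro w hw
    obtain ⟨hwS, hwB⟩ := mem_sdiff.1 hw
    refine desc_induction (f := g) (P := fun w => w ∉ desc g c → w ∈ desc _ v)
      (fun _ => self_mem_desc _ _) (fun w _ _ ih hwB => ?_) (h3 w hwS) hwB
    apply mem_desc_of_apply
    simp only [hwB, if_false]
    exact ih fun h => hwB (mem_desc_of_apply h)
  · ext w
    by_cases hwB : w ∈ desc g c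
    · by_cases hwc : w = c
      · subst hwc; simp [hang, hwB, hgc]
      · simp [hang, hwB, hwc]
    · simp [hang, hwB]

/-- A bound on the probability that, in a uniform tree, more than `M` vertices lie outside the
branch of a given vertex. -/
noncomputable def tailBound (M : ℕ) : ℝ :=
  6 * Real.exp 1 * (∑' n : ℕ, (n : ℝ) ^ (-(5 / 4) : ℝ)) * (M : ℝ) ^ (-(1 / 4) : ℝ)

theorem tendsto_tailBound : Filter.Tendsto tailBound Filter.atTop (nhds 0) := by
  have h := (tendsto_rpow_neg_atTop (show (0 : ℝ) < 1 / 4 by norm_num)).comp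
    (tendsto_natCast_atTop_atTop (R := ℝ))
  have h' := h.const_mul (6 * Real.exp 1 * (∑' n : ℕ, (n : ℝ) ^ (-(5 / 4) : ℝ)))
  rw [mul_zero] at h'
  exact h'

theorem tailBound_nonneg (M : ℕ) : 0 ≤ tailBound M := by
  unfold tailBound
  positivity

theorem sum_branch_weight_le {k M : ℕ} (hk : 2 ≤ k) (hM : 1 ≤ M) :
    ∑ b ∈ range (k - 2 + 1), ((k - 2).choose b : ℝ) *
      (if b + 1 + M < k then ((b + 1 : ℕ) : ℝ) ^ b *
        (((k - (b + 1) : ℕ) : ℝ) ^ (k - (b + 1) - 1) / ((k - (b + 1) : ℕ) : ℝ)) else 0) ≤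
    tailBound M * ((k : ℝ) ^ (k - 1) / k) := by
  set T : ℝ := (k : ℝ) ^ (k - 1) / k with hT
  have hT0 : 0 ≤ T := by positivity
  set Z : ℝ := ∑' n : ℕ, (n : ℝ) ^ (-(5 / 4) : ℝ) with hZ
  have hsum : Summable fun n : ℕ => (n : ℝ) ^ (-(5 / 4) : ℝ) :=
    Real.summable_nat_rpow.2 (by norm_num)
  have hpart : ∑ b ∈ range (k - 2 + 1), ((b + 1 : ℕ) : ℝ) ^ (-(5 / 4) : ℝ) ≤ Z := by
    have h := hsum.sum_le_tsum (range (k - 2 + 1 + 1)) fun i _ => by positivity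
    rw [sum_range_succ'] at h
    exact le_trans (le_add_of_nonneg_right (by positivity)) h
  have hrefl : ∑ b ∈ range (k - 2 + 1), ((k - (b + 1) : ℕ) : ℝ) ^ (-(5 / 4) : ℝ) ≤ Z := by
    refine le_trans (le_of_eq ?_) hpart
    rw [← sum_range_reflect]
    refine sum_congr rfl fun b hb => ?_
    rw [mem_range] at hb
    congr 2
    omega
  calc _ ≤ ∑ b ∈ range (k - 2 + 1), 2 * Real.exp 1 * ((M : ℝ) ^ (-(1 / 4) : ℝ) *
        (2 * ((k - (b + 1) : ℕ) : ℝ) ^ (-(5 / 4) : ℝ) +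
          ((b + 1 : ℕ) : ℝ) ^ (-(5 / 4) : ℝ))) * T := by
        refine sum_le_sum fun b hb => ?_
        split_ifs with h
        · obtain ⟨j, hj⟩ : ∃ j, k = b + 1 + j := ⟨k - (b + 1), by omega⟩
          have hj' : k - (b + 1) = j := by omega
          have h1 := branch_weight_le (m := b + 1) (j := j) (by omega) (by omega)
          have h2 := sqrt_ratio_le (m := b + 1) (j := j) (M := M) (by omega) hM (by omega)
          rw [← hj, Nat.add_sub_cancel] at h1
          rw [← hj] at h2
          rw [hj', ← mul_assoc]
          refine h1.trans ?_
          rw [← hT]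
          gcongr
        · rw [mul_zero]; positivity
    _ = 2 * Real.exp 1 * (M : ℝ) ^ (-(1 / 4) : ℝ) * T *
        (2 * ∑ b ∈ range (k - 2 + 1), ((k - (b + 1) : ℕ) : ℝ) ^ (-(5 / 4) : ℝ) +
          ∑ b ∈ range (k - 2 + 1), ((b + 1 : ℕ) : ℝ) ^ (-(5 / 4) : ℝ)) := by
        rw [mul_sum, ← sum_add_distrib, mul_sum]
        refine sum_congr rfl fun b _ => ?_
        ring
    _ ≤ 2 * Real.exp 1 * (M : ℝ) ^ (-(1 / 4) : ℝ) * T * (2 * Z + Z) := by gcongr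
    _ = _ := by rw [tailBound]; ring

/-- In the tree on `S` rooted at `v` with parent map `g`, more than `M` vertices lie outside the
branch of `u`. -/
def SmallBranch (S : Finset V) (v u : V) (M : ℕ) (g : V → V) : Prop :=
  ∃ c, c ≠ v ∧ g c = v ∧ u ∈ desc g c ∧ (desc g c).card + M < S.card

/-- In a uniform tree, the branch of a given vertex `u` contains all but few vertices. -/
theorem card_branch_add_lt_le {S : Finset V} {v u : V} (hv : v ∈ S) (hu : u ∈ S) (huv : u ≠ v)
    {M : ℕ} (hM : 1 ≤ M) :
    (((forests S {v}).filter (SmallBranch S v u M)).card : ℝ) ≤ tailBound M * (forests S {v}).card := by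
  set W := (S.erase v).erase u with hW
  have huS : u ∈ S.erase v := mem_erase.2 ⟨huv, hu⟩
  have hWcard : W.card = S.card - 2 := by
    rw [hW, card_erase_of_mem huS, card_erase_of_mem hv]; omega
  have hS2 : 2 ≤ S.card := by
    have := card_pos.2 ⟨u, huS⟩
    rw [card_erase_of_mem hv] at this
    omega
  have hsub : (forests S {v}).filter (SmallBranch S v u M) ⊆
      (W.powerset.filter fun B => B.card + 1 + M < S.card).biUnion fun B =>
        (insert u B).biUnion fun c =>
          (forests (insert u B) {c} ×ˢ forests (S \ insert u B) {v}).image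
            (hang v c (insert u B)) := by
    intro g hg
    obtain ⟨hg, c, hcv, hgc, huc, hlt⟩ := mem_filter.1 hg
    obtain ⟨-, h2, -⟩ := mem_forests_singleton.1 hg
    have hcS : c ∈ S := by
      obtain ⟨k, hk⟩ := mem_desc.1 huc
      rw [← hk]
      exact Set.MapsTo.iterate (s := (S : Set V)) (f := g) h2 k hu
    obtain ⟨hBS, p, hp, hpg⟩ := exists_hang_eq hg hcS hcv hgc
    have hins : insert u ((desc g c).erase u) = desc g c := insert_erase huc
    refine mem_biUnion.2 ⟨(desc g c).erase u, mem_filter.2 ⟨mem_powerset.2 ?_, ?_⟩, ?_⟩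
    · exact erase_subset_erase _ hBS
    · rwa [card_erase_add_one huc]
    · rw [hins]
      exact mem_biUnion.2 ⟨c, self_mem_desc _ _, mem_image.2 ⟨p, hp, hpg⟩⟩
  have hle := (card_le_card hsub).trans (card_biUnion_le.trans
    (sum_le_sum fun B _ => card_biUnion_le.trans (sum_le_sum fun c _ => card_image_le)))
  have hle' := (Nat.cast_le (α := ℝ)).2 hle
  push_cast [card_product] at hle'
  refine hle'.trans ?_
  rw [card_tree S hv]
  refine le_trans (le_of_eq ?_) (sum_branch_weight_le hS2 hM)
  rw [← hWcard]
  simp only [← nsmul_eq_mul (Nat.choose _ _)]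
  rw [← sum_powerset_apply_card (fun b => if b + 1 + M < S.card then ((b + 1 : ℕ) : ℝ) ^ b *
        (((S.card - (b + 1) : ℕ) : ℝ) ^ (S.card - (b + 1) - 1) / ((S.card - (b + 1) : ℕ) : ℝ))
        else 0), ← sum_filter]
  refine sum_congr rfl fun B hB => ?_
  obtain ⟨hB, -⟩ := mem_filter.1 hB
  rw [mem_powerset] at hB
  have huB : u ∉ B := fun h => by simpa [hW] using hB h
  have hvB : v ∉ insert u B := fun h => by
    rcases mem_insert.1 h with h | h
    · exact huv h.symm
    · simpa [hW] using hB h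
  have hiS : insert u B ⊆ S := insert_subset hu
    (hB.trans ((erase_subset _ _).trans (erase_subset _ _)))
  have hc : (S \ insert u B).card = S.card - (B.card + 1) := by
    rw [card_sdiff_of_subset hiS, card_insert_of_notMem huB]
  rw [sum_congr rfl fun c hc => by rw [card_tree _ hc]]
  rw [sum_const, card_tree _ (mem_sdiff.2 ⟨hv, hvB⟩), hc, card_insert_of_notMem huB, nsmul_eq_mul,
    Nat.add_sub_cancel]
  have : ((B.card + 1 : ℕ) : ℝ) ≠ 0 := by positivity
  field_simp

end Branches

section Exploration
variable {m : ℕ}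

theorem IsPTree.mem_desc_root {par : Fin m → Fin m} {r : Fin m} (h : IsPTree par r) (v : Fin m) :
    v ∈ desc par r := mem_desc.2 (h.2 v)

/-- The invariants of the depth-first exploration of a tree. -/
structure DfsInv (par : Fin m → Fin m) (r : Fin m) (s : St m) : Prop where
  par_mem : ∀ w, w ∈ s.stack ∨ w ∈ s.visited → w ≠ r → par w ∈ s.visited
  child_mem : ∀ w, w ≠ r → par w ∈ s.visited → w ∈ s.stack ∨ w ∈ s.visited
  root_mem : r ∈ s.stack ∨ r ∈ s.visited
  nodup_stack : s.stack.Nodup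
  nodup_visited : s.visited.Nodup
  disjoint : ∀ w ∈ s.stack, w ∉ s.visited

theorem DfsInv.start (par : Fin m → Fin m) (r : Fin m) : DfsInv par r ⟨[r], []⟩ where
  par_mem := by simp
  child_mem := by simp
  root_mem := by simp
  nodup_stack := by simp
  nodup_visited := by simp
  disjoint := by simp

theorem DfsInv.mem_visited {par : Fin m → Fin m} {r : Fin m} {s : St m} (hT : IsPTree par r)
    (h : DfsInv par r s) (hs : s.stack = []) (w : Fin m) : w ∈ s.visited := by
  have hor : ∀ {x : Fin m}, x ∈ s.stack ∨ x ∈ s.visited → x ∈ s.visited := by simp [hs]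
  exact desc_induction (P := (· ∈ s.visited)) (hor h.root_mem)
    (fun x _ hx ih => hor (h.child_mem x hx ih)) (hT.mem_desc_root w)

/-- The children of `v` pushed on the stack when `v` is explored. -/
def pushed (adj : Fin m → Fin m → Bool) (s : St m) (v : Fin m) : List (Fin m) :=
  (List.finRange m).filter
    (fun w => adj v w && !(decide (w ∈ s.stack)) && !(decide (w ∈ s.visited)))

theorem mem_pushed {par : Fin m → Fin m} {r : Fin m} {s : St m} {v w : Fin m} :
    w ∈ pushed (childAdj par r) s v ↔
      w ≠ r ∧ par w = v ∧ w ∉ s.stack ∧ w ∉ s.visited := by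
  simp [pushed, childAdj, and_assoc]

theorem DfsInv.next {par : Fin m → Fin m} {r : Fin m} {s : St m} (h : DfsInv par r s)
    {v : Fin m} {rest : List (Fin m)} (hs : s.stack = v :: rest) :
    DfsInv par r ⟨pushed (childAdj par r) s v ++ rest, s.visited ++ [v]⟩ := by
  have hv : v ∈ s.stack := by simp [hs]
  have hnd : (v :: rest).Nodup := hs ▸ h.nodup_stack
  have hrest : ∀ w ∈ rest, w ∈ s.stack := fun w hw => by simp [hs, hw]
  have hcases : ∀ w, w ∈ s.stack → w = v ∨ w ∈ rest := fun w hw => by simpa [hs] using hw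
  constructor
  · intro w hw hwr
    simp only [List.mem_append, mem_pushed, List.mem_singleton] at hw ⊢
    rcases hw with (hw | hw) | hw | hw
    · exact Or.inr hw.2.1
    · exact Or.inl (h.par_mem w (Or.inl (hrest w hw)) hwr)
    · exact Or.inl (h.par_mem w (Or.inr hw) hwr)
    · exact Or.inl (h.par_mem w (Or.inl (hw ▸ hv)) hwr)
  · intro w hwr hw
    simp only [List.mem_append, mem_pushed, List.mem_singleton] at hw ⊢
    by_cases h1 : w ∈ s.stack
    · rcases hcases w h1 with h2 | h2 <;> simp [h2]
    by_cases h2 : w ∈ s.visited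
    · simp [h2]
    rcases hw with hw | hw
    · exact absurd (h.child_mem w hwr hw) (by simp [h1, h2])
    · exact Or.inl (Or.inl ⟨hwr, hw, h1, h2⟩)
  · simp only [List.mem_append, List.mem_singleton]
    rcases h.root_mem with h1 | h1
    · rcases hcases r h1 with h2 | h2 <;> simp [h2]
    · simp [h1]
  · refine List.Nodup.append ((List.nodup_finRange m).filter _) (List.nodup_cons.1 hnd).2 ?_
    intro w hw hw'
    exact (mem_pushed.1 hw).2.2.1 (hrest w hw')
  · refine List.Nodup.append h.nodup_visited (List.nodup_singleton v) ?_
    intro w hw hw'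
    exact h.disjoint v hv (List.mem_singleton.1 hw' ▸ hw)
  · intro w hw hw'
    simp only [List.mem_append, mem_pushed, List.mem_singleton] at hw hw'
    rcases hw with hw | hw <;> rcases hw' with hw' | hw'
    · exact hw.2.2.2 hw'
    · exact hw.2.2.1 (hw' ▸ hv)
    · exact h.disjoint w (hrest w hw) hw'
    · exact (List.nodup_cons.1 hnd).1 (hw' ▸ hw)

theorem step_eq {par : Fin m → Fin m} {r : Fin m} {s : St m} (hT : IsPTree par r)
    (h : DfsInv par r s) {v : Fin m} {rest : List (Fin m)} (hs : s.stack = v :: rest) :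
    step (childAdj par r) s =
      ⟨pushed (childAdj par r) s v ++ rest, s.visited ++ [v]⟩ := by
  obtain ⟨st, vis⟩ := s
  simp only at hs
  subst hs
  have hn := h.next rfl
  simp only [step]
  split_ifs with he
  · replace he : pushed (childAdj par r) ⟨v :: rest, vis⟩ v ++ rest = [] := List.isEmpty_iff.1 he
    have hall := hn.mem_visited hT he
    congr 1
    rw [he, List.filter_eq_nil_iff.2]
    · rfl
    · intro w _
      simpa [or_iff_not_imp_left] using hall w
  · rfl

theorem stateAt_succ (adj : Fin m → Fin m → Bool) (r : Fin m) (i : ℕ) :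
    stateAt adj r (i + 1) = step adj (stateAt adj r i) := by
  rw [stateAt, Function.iterate_succ_apply', stateAt]

theorem visited_step_mono (adj : Fin m → Fin m → Bool) (s : St m) :
    s.visited <+: (step adj s).visited := by
  obtain ⟨_ | ⟨v, rest⟩, vis⟩ := s
  · exact List.prefix_rfl
  · exact List.prefix_append _ _

theorem visited_mono (adj : Fin m → Fin m → Bool) (r : Fin m) {i j : ℕ} (hij : i ≤ j) :
    (stateAt adj r i).visited <+: (stateAt adj r j).visited := by
  induction j, hij using Nat.le_induction with
  | base => exact List.prefix_rfl
  | succ j _ ih =>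
    rw [stateAt_succ]
    exact ih.trans (visited_step_mono _ _)

theorem dfsInv_stateAt {par : Fin m → Fin m} {r : Fin m} (hT : IsPTree par r) (i : ℕ) :
    DfsInv par r (stateAt (childAdj par r) r i) := by
  induction i with
  | zero => exact DfsInv.start par r
  | succ i ih =>
    rw [stateAt_succ]
    rcases hs : (stateAt (childAdj par r) r i).stack with _ | ⟨v, rest⟩
    · simpa only [step, hs] using ih
    · rw [step_eq hT ih hs]
      exact ih.next hs

theorem length_visited {par : Fin m → Fin m} {r : Fin m} (hT : IsPTree par r) {i : ℕ}
    (hi : i ≤ m) : (stateAt (childAdj par r) r i).visited.length = i ∧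
      (i < m → (stateAt (childAdj par r) r i).stack ≠ []) := by
  have hne : ∀ j, (stateAt (childAdj par r) r j).visited.length = j → j < m →
      (stateAt (childAdj par r) r j).stack ≠ [] := by
    intro j hj hjm hs
    have hall := (dfsInv_stateAt hT j).mem_visited hT hs
    have hu : (stateAt (childAdj par r) r j).visited.toFinset = univ := by
      ext w; simpa using hall w
    have := List.toFinset_card_le (stateAt (childAdj par r) r j).visited
    rw [hu, card_univ, Fintype.card_fin, hj] at this
    omega
  suffices h : (stateAt (childAdj par r) r i).visited.length = i from ⟨h, hne i h⟩
  induction i with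
  | zero => rfl
  | succ i ih =>
    have hl := ih (by omega)
    rcases hs : (stateAt (childAdj par r) r i).stack with _ | ⟨v, rest⟩
    · exact absurd hs (hne i hl (by omega))
    · rw [stateAt_succ, step_eq hT (dfsInv_stateAt hT i) hs]
      simp [hl]

/-- The vertex at position `i` of the depth-first order is on top of the stack after `i` steps. -/
theorem stack_eq_getD {par : Fin m → Fin m} {r : Fin m} (hT : IsPTree par r) {i : ℕ}
    (hi : i < m) : ∃ rest, (stateAt (childAdj par r) r i).stack =
      (dfsOrder par r).getD i r :: rest := by
  obtain ⟨hl, hne⟩ := length_visited hT hi.le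
  rcases hs : (stateAt (childAdj par r) r i).stack with _ | ⟨v, rest⟩
  · exact absurd hs (hne hi)
  refine ⟨rest, ?_⟩
  have hp := visited_mono (childAdj par r) r (show i + 1 ≤ m from hi)
  rw [stateAt_succ, step_eq hT (dfsInv_stateAt hT i) hs] at hp
  obtain ⟨t, ht⟩ := hp
  rw [dfsOrder, ← ht]
  simp [List.getD, hl]

theorem notMem_desc_of_mem_visited {par : Fin m → Fin m} {r : Fin m} (hT : IsPTree par r) {i : ℕ}
    (hi : i < m) {w : Fin m} (hw : w ∈ (stateAt (childAdj par r) r i).visited) :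
    w ∉ desc par ((dfsOrder par r).getD i r) := by
  have hinv := dfsInv_stateAt hT i
  obtain ⟨rest, hs⟩ := stack_eq_getD hT hi
  have hclosed : ∀ w ∈ (stateAt (childAdj par r) r i).visited,
      par w ∈ (stateAt (childAdj par r) r i).visited := by
    intro w hw
    by_cases hwr : w = r
    · rw [hwr, hT.1]; exact hwr ▸ hw
    · exact hinv.par_mem w (Or.inr hw) hwr
  intro hd
  obtain ⟨k, hk⟩ := mem_desc.1 hd
  have hmem := Set.MapsTo.iterate (s := {w | w ∈ (stateAt (childAdj par r) r i).visited})
    (f := par) hclosed k hw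
  rw [hk] at hmem
  exact hinv.disjoint _ (by rw [hs]; exact List.mem_cons_self) hmem

/-- Rearranging the subtree of the vertex at position `i` does not change that vertex. -/
theorem getD_dfsOrder_congr {par par' : Fin m → Fin m} {r : Fin m} (hT : IsPTree par r)
    (hT' : IsPTree par' r) {i : ℕ} (hi : i < m) {v : Fin m}
    (hv : (dfsOrder par r).getD i r = v)
    (hout : ∀ w, (w ∈ desc par v → w = v) → par' w = par w)
    (hin : ∀ w ∈ desc par v, w ≠ v → par' w ∈ desc par v) :
    (dfsOrder par' r).getD i r = v := by
  have hstate : ∀ j ≤ i, stateAt (childAdj par' r) r j = stateAt (childAdj par r) r j := by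
    intro j hj
    induction j with
    | zero => rfl
    | succ j ih =>
      have ihj := ih (by omega)
      rcases hs : (stateAt (childAdj par r) r j).stack with _ | ⟨x, rest⟩
      · exact absurd hs ((length_visited hT (by omega)).2 (by omega))
      have hx : x ∉ desc par v := by
        rw [← hv]
        refine notMem_desc_of_mem_visited hT hi ((visited_mono _ _ hj).subset ?_)
        rw [stateAt_succ, step_eq hT (dfsInv_stateAt hT j) hs]
        simp
      rw [stateAt_succ, stateAt_succ, step_eq hT (dfsInv_stateAt hT j) hs,
        step_eq hT' (dfsInv_stateAt hT' j) (ihj ▸ hs), ihj]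
      have hadj : childAdj par' r x = childAdj par r x := by
        ext w
        have : par' w = x ↔ par w = x := by
          by_cases hw : w ∈ desc par v → w = v
          · rw [hout w hw]
          · push Not at hw
            exact ⟨fun h => absurd (h ▸ hin w hw.1 hw.2) hx,
              fun h => absurd (h ▸ apply_mem_desc hw.1 hw.2) hx⟩
        simp [childAdj, this]
      have : pushed (childAdj par' r) (stateAt (childAdj par r) r j) x =
          pushed (childAdj par r) (stateAt (childAdj par r) r j) x := by
        simp only [pushed, hadj]
      rw [this]
  obtain ⟨rest, hs⟩ := stack_eq_getD hT hi
  obtain ⟨rest', hs'⟩ := stack_eq_getD hT' hi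
  rw [hstate i le_rfl, hs, List.cons.injEq] at hs'
  rw [← hs'.1, hv]

end Exploration

section Subtree
variable {V : Type*} [DecidableEq V]

/-- The map equal to `f` on `S \ {v}` and to `h` elsewhere. -/
def splice (S : Finset V) (v : V) (f h : V → V) : V → V :=
  fun w => if w ∈ S ∧ w ≠ v then f w else h w

theorem splice_of_mem {S : Finset V} {v w : V} (f h : V → V) (hw : w ∈ S) (hwv : w ≠ v) :
    splice S v f h w = f w := if_pos ⟨hw, hwv⟩

theorem splice_of_imp {S : Finset V} {v w : V} (f h : V → V) (hw : w ∈ S → w = v) :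
    splice S v f h w = h w := if_neg fun hn => hn.2 (hw hn.1)

variable {m : ℕ} {par : Fin m → Fin m} {r v : Fin m}

theorem desc_trans {f : Fin m → Fin m} {a b c : Fin m} (hab : a ∈ desc f b) (hbc : b ∈ desc f c) :
    a ∈ desc f c :=
  desc_induction (P := (· ∈ desc f c)) hbc (fun _ _ _ ih => mem_desc_of_apply ih) hab

theorem IsPTree.eq_root_of_apply_mem_desc (hT : IsPTree par r) (h : par v ∈ desc par v) :
    v = r := by
  obtain ⟨p, hp⟩ := mem_desc.1 h
  obtain ⟨K, hK⟩ := hT.2 v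
  have h1 : par^[(p + 1) * K] v = v := by
    rw [Function.iterate_mul]
    exact Function.iterate_fixed hp K
  rw [add_mul, one_mul, Function.iterate_add_apply, hK, Function.iterate_fixed hT.1] at h1
  exact h1.symm

theorem splice_mem_forests (par : Fin m → Fin m) (v : Fin m) :
    splice (desc par v) v par id ∈ forests (desc par v) {v} := by
  refine mem_forests_singleton.2 ⟨fun w hw => splice_of_imp _ _ hw, fun w hw => ?_, fun w hw => ?_⟩
  · by_cases hwv : w = v
    · rw [splice_of_imp _ _ fun _ => hwv]; exact hw
    · rw [splice_of_mem _ _ hw hwv]; exact apply_mem_desc hw hwv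
  · refine desc_induction (P := (· ∈ desc _ v)) (self_mem_desc _ _) (fun x hx hxv ih => ?_) hw
    apply mem_desc_of_apply
    rwa [splice_of_mem _ _ hx hxv]

theorem desc_splice_child (hT : IsPTree par r) {c : Fin m} (hcv : c ≠ v) (hc : par c = v) :
    desc (splice (desc par v) v par id) c = desc par c := by
  have hcS : c ∈ desc par v := mem_desc_of_apply (hc ▸ self_mem_desc par v)
  ext w
  constructor <;> intro hw
  · refine desc_induction (P := (· ∈ desc par c)) (self_mem_desc _ _) (fun x _ _ ih => ?_) hw
    by_cases hx : x ∈ desc par v → x = v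
    · rwa [splice_of_imp _ _ hx] at ih
    · push Not at hx
      rw [splice_of_mem _ _ hx.1 hx.2] at ih
      exact mem_desc_of_apply ih
  · refine desc_induction (P := (· ∈ desc _ c)) (self_mem_desc _ _) (fun x hx hxc ih => ?_) hw
    have hxv : x ≠ v := by
      rintro rfl
      have hr := hT.eq_root_of_apply_mem_desc (desc_trans (apply_mem_desc hx hxc) hcS)
      obtain ⟨k, hk⟩ := mem_desc.1 hx
      rw [hr, Function.iterate_fixed hT.1, ← hr] at hk
      exact hxc hk
    apply mem_desc_of_apply
    rwa [splice_of_mem _ _ (desc_trans hx hcS) hxv]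

theorem exists_branch (hT : IsPTree par r) {u : Fin m} (hu : u ∈ desc par v) (huv : u ≠ v) :
    ∃ c, c ≠ r ∧ c ≠ v ∧ par c = v ∧ u ∈ desc par c := by
  refine desc_induction (P := fun w => w ≠ v → ∃ c, c ≠ r ∧ c ≠ v ∧ par c = v ∧ w ∈ desc par c)
    (fun h => absurd rfl h) (fun w _ _ ih hwv => ?_) hu huv
  by_cases h : par w = v
  · refine ⟨w, ?_, hwv, h, self_mem_desc _ _⟩
    rintro rfl
    exact hwv (hT.1.symm.trans h)
  · obtain ⟨c, h1, h2, h3, h4⟩ := ih h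
    exact ⟨c, h1, h2, h3, mem_desc_of_apply h4⟩

theorem subSize_eq (par : Fin m → Fin m) (v : Fin m) : subSize par v = (desc par v).card := by
  rw [subSize, ← Set.ncard_coe_finset]
  congr 1
  ext w
  simp [mem_desc]

theorem desc_card_add_lt {c : Fin m} {M : ℕ} (h : M < outsideLargest par r v) (hcr : c ≠ r)
    (hc : par c = v) : (desc par c).card + M < (desc par v).card := by
  have hle : subSize par c ≤
      (univ.filter (fun c : Fin m => c ≠ r ∧ par c = v)).sup (subSize par) :=
    le_sup (f := subSize par) (by simp [hcr, hc])
  rw [outsideLargest] at h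
  rw [← subSize_eq, ← subSize_eq]
  omega

section Regraft
variable {g : Fin m → Fin m}

theorem splice_apply_of_mem_desc (hg : g ∈ forests (desc par v) {v}) {w : Fin m}
    (hw : w ∈ desc par v) : w ∈ desc (splice (desc par v) v g par) v := by
  obtain ⟨h1, h2, h3⟩ := mem_forests_singleton.1 hg
  refine desc_induction (f := g) (P := fun w => w ∈ desc par v → w ∈ desc _ v)
    (fun _ => self_mem_desc _ _) (fun x _ hxv ih hx => ?_) (h3 w hw) hw
  apply mem_desc_of_apply
  rw [splice_of_mem _ _ hx hxv]
  exact ih (h2 x hx)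

theorem desc_splice (hg : g ∈ forests (desc par v) {v}) :
    desc (splice (desc par v) v g par) v = desc par v := by
  ext w
  refine ⟨fun hw => ?_, splice_apply_of_mem_desc hg⟩
  refine desc_induction (P := (· ∈ desc par v)) (self_mem_desc _ _) (fun x _ _ ih => ?_) hw
  by_contra hx
  rw [splice_of_imp _ _ fun h => absurd h hx] at ih
  exact hx (mem_desc_of_apply ih)

theorem isPTree_splice (hT : IsPTree par r) (hg : g ∈ forests (desc par v) {v}) :
    IsPTree (splice (desc par v) v g par) r := by
  have hout : ∀ w, (w ∈ desc par v → w = v) → w ∈ desc (splice (desc par v) v g par) r := by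
    intro w hw
    refine desc_induction (f := par)
      (P := fun w => (w ∈ desc par v → w = v) → w ∈ desc (splice (desc par v) v g par) r)
      (fun _ => self_mem_desc _ _) (fun x _ hxr ih hx => ?_) (hT.mem_desc_root w) hw
    apply mem_desc_of_apply
    rw [splice_of_imp _ _ hx]
    refine ih fun hpx => ?_
    have hxv := hx (mem_desc_of_apply hpx)
    subst hxv
    exact absurd (hT.eq_root_of_apply_mem_desc hpx) hxr
  refine ⟨?_, fun w => mem_desc.1 ?_⟩
  · rw [splice_of_imp, hT.1]
    intro hr
    obtain ⟨k, hk⟩ := mem_desc.1 hr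
    rwa [Function.iterate_fixed hT.1] at hk
  · by_cases hw : w ∈ desc par v
    · exact desc_trans (splice_apply_of_mem_desc hg hw) (hout v fun _ => rfl)
    · exact hout w fun h => absurd h hw

theorem getD_dfsOrder_splice (hT : IsPTree par r) {i : ℕ} (hi : i < m)
    (hv : (dfsOrder par r).getD i r = v) (hg : g ∈ forests (desc par v) {v}) :
    (dfsOrder (splice (desc par v) v g par) r).getD i r = v := by
  refine getD_dfsOrder_congr hT (isPTree_splice hT hg) hi hv (fun w hw => splice_of_imp _ _ hw)
    fun w hw hwv => ?_
  rw [splice_of_mem _ _ hw hwv]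
  exact (mem_forests_singleton.1 hg).2.1 w hw

end Regraft

/-- The vertex at position `i`, its set of descendants, and the tree outside of its subtree. -/
noncomputable def outerTree (r : Fin m) (i : ℕ) (par : Fin m → Fin m) :
    Fin m × Finset (Fin m) × (Fin m → Fin m) :=
  let v := (dfsOrder par r).getD i r
  (v, desc par v, splice (desc par v) v id par)

theorem mem_treeFinset : par ∈ treeFinset m r ↔ IsPTree par r := by
  simp [treeFinset]

theorem card_fiber_le {par₀ : Fin m → Fin m} (hT₀ : IsPTree par₀ r) {i : ℕ} (hi : i < m) {M : ℕ}
    (hM : 1 ≤ M) :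
    ((((treeFinset m r).filter (fun par =>
        M < outsideLargest par r ((dfsOrder par r).getD i r))).filter
          fun par => outerTree r i par = outerTree r i par₀).card : ℝ) ≤
      tailBound M *
        ((treeFinset m r).filter fun par => outerTree r i par = outerTree r i par₀).card := by
  set v := (dfsOrder par₀ r).getD i r with hv
  set S := desc par₀ v with hS
  have hx : outerTree r i par₀ = (v, S, splice S v id par₀) := rfl
  have hfib : ∀ par, outerTree r i par = outerTree r i par₀ →
      (dfsOrder par r).getD i r = v ∧ desc par v = S ∧ splice S v id par = splice S v id par₀ := by
    intro par h
    rw [hx, outerTree] at h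
    simp only [Prod.mk.injEq] at h
    obtain ⟨h1, h2, h3⟩ := h
    rw [h1] at h2 h3
    rw [h2] at h3
    exact ⟨h1, h2, h3⟩
  have hge : (forests S {v}).card ≤
      ((treeFinset m r).filter fun par => outerTree r i par = outerTree r i par₀).card := by
    refine card_le_card_of_injOn (fun g => splice S v g par₀) (fun g hg => ?_)
      fun g hg g' hg' h => ?_
    · have hg' : g ∈ forests S {v} := hg
      refine mem_coe.2 (mem_filter.2 ⟨mem_treeFinset.2 (isPTree_splice hT₀ hg'), ?_⟩)
      rw [hx, outerTree]
      simp only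
      rw [getD_dfsOrder_splice hT₀ hi hv.symm hg', desc_splice hg']
      refine Prod.ext rfl (Prod.ext rfl (funext fun w => ?_))
      change splice S v id (splice S v g par₀) w = splice S v id par₀ w
      by_cases hw : w ∈ S → w = v
      · simp only [splice_of_imp _ _ hw]
      · push Not at hw
        simp only [splice_of_mem _ _ hw.1 hw.2]
    · funext w
      by_cases hw : w ∈ S → w = v
      · rw [(mem_forests_singleton.1 hg).1 w hw, (mem_forests_singleton.1 hg').1 w hw]
      · push Not at hw
        simpa only [splice_of_mem _ _ hw.1 hw.2] using congrFun h w
  by_cases hu : ∃ u ∈ S, u ≠ v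
  · obtain ⟨u, huS, huv⟩ := hu
    refine le_trans ?_ ((card_branch_add_lt_le (self_mem_desc _ _) huS huv hM).trans
      (mul_le_mul_of_nonneg_left (Nat.cast_le.2 hge) (tailBound_nonneg M)))
    refine Nat.cast_le.2 (card_le_card_of_injOn (fun par => splice S v par id)
      (fun par hp => ?_) fun par hp par' hp' h => ?_)
    · obtain ⟨hp, hpx⟩ := mem_filter.1 (mem_coe.1 hp)
      obtain ⟨hT, hlt⟩ := mem_filter.1 hp
      rw [mem_treeFinset] at hT
      obtain ⟨h1, h2, -⟩ := hfib par hpx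
      rw [h1] at hlt
      obtain ⟨c, hcr, hcv, hc, huc⟩ := exists_branch hT (h2.symm ▸ huS) huv
      have hcS : c ∈ desc par v := mem_desc_of_apply (hc ▸ self_mem_desc par v)
      have hcard := desc_card_add_lt hlt hcr hc
      have hmem := splice_mem_forests par v
      have hdesc := desc_splice_child hT hcv hc
      rw [h2] at hmem hdesc hcS hcard
      rw [mem_coe, mem_filter]
      refine ⟨hmem, c, hcv, ?_, ?_, ?_⟩
      · exact (splice_of_mem _ _ hcS hcv).trans hc
      · rwa [hdesc]
      · rwa [hdesc]
    · have h3 := (hfib par (mem_filter.1 (mem_coe.1 hp)).2).2.2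
      have h3' := (hfib par' (mem_filter.1 (mem_coe.1 hp')).2).2.2
      funext w
      by_cases hw : w ∈ S → w = v
      · simpa only [splice_of_imp _ _ hw] using congrFun (h3.trans h3'.symm) w
      · push Not at hw
        simpa only [splice_of_mem _ _ hw.1 hw.2] using congrFun h w
  · push Not at hu
    rw [filter_filter, filter_eq_empty_iff.2, card_empty, Nat.cast_zero]
    · exact mul_nonneg (tailBound_nonneg M) (Nat.cast_nonneg _)
    · rintro par - ⟨hlt, hpx⟩
      obtain ⟨h1, h2, -⟩ := hfib par hpx
      have hle : outsideLargest par r v ≤ (desc par v).card := by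
        rw [← subSize_eq]; exact Nat.sub_le _ _
      have hone : S.card ≤ 1 := card_le_one.2 fun a ha b hb => (hu a ha).trans (hu b hb).symm
      rw [h1] at hlt
      rw [h2] at hle
      omega

theorem card_outsideLargest_le (r : Fin m) {i : ℕ} (hi : i < m) {M : ℕ} (hM : 1 ≤ M) :
    (((treeFinset m r).filter (fun par =>
        M < outsideLargest par r ((dfsOrder par r).getD i r))).card : ℝ) ≤
      tailBound M * (treeFinset m r).card := by
  have hmaps : ∀ T ⊆ treeFinset m r, ∀ par ∈ T,
      outerTree r i par ∈ (treeFinset m r).image (outerTree r i) :=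
    fun T hT par hpar => mem_image_of_mem _ (hT hpar)
  rw [card_eq_sum_card_fiberwise (hmaps _ (filter_subset _ _)),
    card_eq_sum_card_fiberwise (hmaps (treeFinset m r) subset_rfl)]
  push_cast
  rw [mul_sum]
  refine sum_le_sum fun x hx => ?_
  obtain ⟨par₀, hpar₀, rfl⟩ := mem_image.1 hx
  exact card_fiber_le (mem_treeFinset.1 hpar₀) hi hM

end Subtree

end RandomTree

open RandomTree Filter in
/-- Let `𝖳_n` be a uniformly random labelled tree on `[n]` rooted at
vertex `1` with vertices `v₁, …, v_n` in the planar (depth-first) order of its canonical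
planar embedding, and for a vertex `v` let `Y_v(n)` be the number of vertices of the
subtree rooted at `v` lying outside the largest subtree rooted at a child of `v` (ties do
not matter, the count depending only on the largest size).  Then
`lim_{M→∞} limsup_{n→∞} sup_{1 ≤ i ≤ n} P[Y_{vᵢ}(n) > M] = 0`. -/
theorem uniform_tree_outsideLargest_tight :
    Tendsto (fun M : ℕ => Filter.limsup (fun n : ℕ =>
      ⨆ i : Fin n,
        (let r : Fin n := ⟨0, Nat.lt_of_le_of_lt (Nat.zero_le _) i.isLt⟩
        (((treeFinset n r).filter (fun par =>
            M < outsideLargest par r ((dfsOrder par r).getD i.1 r))).card : ℝ)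
          / ((treeFinset n r).card : ℝ))) atTop) atTop (nhds 0) := by
  have hbound : ∀ M : ℕ, 1 ≤ M → ∀ n : ℕ, ∀ i : Fin n,
      (let r : Fin n := ⟨0, Nat.lt_of_le_of_lt (Nat.zero_le _) i.isLt⟩
      (((treeFinset n r).filter (fun par =>
          M < outsideLargest par r ((dfsOrder par r).getD i.1 r))).card : ℝ)
        / ((treeFinset n r).card : ℝ)) ≤ tailBound M := fun M hM n i =>
    div_le_of_le_mul₀ (Nat.cast_nonneg _) (tailBound_nonneg M) (card_outsideLargest_le _ i.2 hM)
  refine tendsto_of_tendsto_of_tendsto_of_le_of_le' tendsto_const_nhds tendsto_tailBound ?_ ?_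
  · filter_upwards [eventually_ge_atTop 1] with M hM
    refine le_limsup_of_frequently_le (Frequently.of_forall fun n => Real.iSup_nonneg fun i =>
      by positivity) ⟨tailBound M, ?_⟩
    exact eventually_map.2 (Eventually.of_forall fun n =>
      Real.iSup_le (hbound M hM n) (tailBound_nonneg M))
  · filter_upwards [eventually_ge_atTop 1] with M hM
    refine limsup_le_of_le ⟨0, fun a ha => ?_⟩ (Eventually.of_forall fun n =>
      Real.iSup_le (hbound M hM n) (tailBound_nonneg M))
    obtain ⟨n, hn⟩ := (eventually_map.1 ha).exists
    exact le_trans (Real.iSup_nonneg fun i => by positivity) hn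
end
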